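/- arXiv:1909.12575 — 3 statements merged into one kernel-verified Lean document; each statement's English description precedes it below -/
import Mathlib

section
/- Let n >= 1 and Γ_n = ∏_{1 <= i < j <= n} (x_i + v^{-1} y_j)(y_i + v^{-1} x_j). Then the doubly skew-symmetrization ASym_{S_n x S_n}(Γ_n) (average over sigma, tau in S_n of sign(sigma) sign(tau) Γ_n(x_{sigma(1)},...,x_{sigma(n)}, y_{tau(1)},...,y_{tau(n)})) is a nonzero rational multiple (in C(v)) of ∏_{i<j}(x_i - x_j) ∏_{i<j}(y_i - y_j), in particular it is nonzero for generic v; equivalently, the coefficient of x_1^{n-1} y_1^{n-1} in ASym_{S_n x S_n}(Γ_n) equals (1 - v^{-2n})/(n^2 (1 - v^{-2})) times ASym_{S_{n-1} x S_{n-1}}(Γ_{n-1}(x_2,...,x_n, y_2,...,y_n)). -/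
open MvPolynomial Equiv

/-- The field ℂ(v) of rational functions. -/
noncomputable abbrev Kv : Type := RatFunc ℂ

/-- Polynomials in `x_1,…,x_n, y_1,…,y_n` over ℂ(v). -/
noncomputable abbrev PP (n : ℕ) : Type := MvPolynomial (Fin n ⊕ Fin n) Kv

/-- The set of pairs `i < j`. -/
def pairs (m : ℕ) : Finset (Fin m × Fin m) :=
  Finset.univ.filter (fun p : Fin m × Fin m => p.1 < p.2)

/-- The doubly skew-symmetrization `ASym_{S_m × S_m}(Γ_m)` of
`Γ_m = ∏_{i<j} (x_i + v⁻¹ y_j)(y_i + v⁻¹ x_j)`, where the `m` `x`-variables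
(resp. `y`-variables) used are `x_{e(1)},…,x_{e(m)}` for an embedding `e : Fin m → Fin n`. -/
noncomputable def ASymGamma (n m : ℕ) (e : Fin m → Fin n) : PP n :=
  ((m.factorial * m.factorial : Kv))⁻¹ •
    ∑ σ : Perm (Fin m), ∑ τ : Perm (Fin m),
      ((Equiv.Perm.sign σ : ℤ) * (Equiv.Perm.sign τ : ℤ)) •
        ∏ p ∈ pairs m,
          (X (Sum.inl (e (σ p.1))) + C (RatFunc.X)⁻¹ * X (Sum.inr (e (τ p.2)))) *
          (X (Sum.inr (e (τ p.1))) + C (RatFunc.X)⁻¹ * X (Sum.inl (e (σ p.2))))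

/-- The coefficient of `x_1^{n-1} y_1^{n-1}` of a polynomial `P`, as a polynomial in
the remaining variables. -/
noncomputable def topCoeff (n : ℕ) (hn : 1 ≤ n) (P : PP n) : PP n :=
  ∑ m ∈ P.support.filter
      (fun m => m (Sum.inl ⟨0, hn⟩) = n - 1 ∧ m (Sum.inr ⟨0, hn⟩) = n - 1),
    monomial ((m.update (Sum.inl ⟨0, hn⟩) 0).update (Sum.inr ⟨0, hn⟩) 0) (P.coeff m)

/-- The product `Γ` over ordered pairs of distinct positions, in any commutative ring. -/
def Gam {A : Type*} [CommRing A] (m : ℕ) (q : A) (x y : Fin m → A) : A :=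
  ∏ a, ∏ b, if a = b then 1 else if a < b then x a + q * y b else y b + q * x a

theorem Gam_eq_pairs {A : Type*} [CommRing A] (m : ℕ) (q : A) (x y : Fin m → A) :
    ∏ p ∈ pairs m, ((x p.1 + q * y p.2) * (y p.1 + q * x p.2)) = Gam m q x y := by
  have h : Gam m q x y = ∏ a, ∏ b, ((if a < b then x a + q * y b else 1) *
      (if b < a then y b + q * x a else 1)) := by
    unfold Gam
    refine Finset.prod_congr rfl fun a _ => Finset.prod_congr rfl fun b _ => ?_
    rcases lt_trichotomy a b with h | h | h
    · simp [h, h.ne, h.not_gt]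
    · simp [h]
    · simp [h, h.ne', h.not_gt]
  rw [h]
  simp only [Finset.prod_mul_distrib]
  rw [Finset.prod_comm (f := fun a b => if b < a then y b + q * x a else 1)]
  unfold pairs
  simp only [Finset.prod_filter, ← Finset.univ_product_univ, Finset.prod_product]

theorem map_Gam {A B : Type*} [CommRing A] [CommRing B] (f : A →+* B) (m : ℕ) (q : A)
    (x y : Fin m → A) : f (Gam m q x y) = Gam m (f q) (fun a => f (x a)) (fun a => f (y a)) := by
  unfold Gam
  simp only [map_prod]
  refine Finset.prod_congr rfl fun a _ => Finset.prod_congr rfl fun b _ => ?_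
  split_ifs <;> simp

theorem prod_pow_pos {A : Type*} [CommRing A] (m : ℕ) (q : A) (k : Fin (m+1)) :
    ∏ j : Fin m, (if k < k.succAbove j then 1 else q) = q ^ (k : ℕ) := by
  have h : ∏ b : Fin (m+1), (if k ≤ b then 1 else q) = q ^ (k : ℕ) := by
    rw [Finset.prod_ite]
    simp only [Finset.prod_const_one, one_mul, Finset.prod_const, not_le]
    congr 1
    rw [← Fin.card_Iio]
    congr 1
    ext; simp
  rw [← h, Fin.prod_univ_succAbove _ k]
  simp only [le_refl, if_true, one_mul]
  refine Finset.prod_congr rfl fun j _ => ?_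
  have := Fin.ne_succAbove k j
  simp [lt_iff_le_and_ne, this]

theorem coeff_outer {A : Type*} [CommRing A] (m : ℕ) (q : A) (x y : Fin (m+1) → A)
    (k : Fin (m+1)) :
    (Gam (m+1) (Polynomial.C q) (fun a => if a = k then Polynomial.X else Polynomial.C (x a))
      (fun b => Polynomial.C (y b))).coeff m =
    q ^ (k : ℕ) * ∏ j : Fin m, ∏ b, if k.succAbove j = b then 1 else
      if k.succAbove j < b then x (k.succAbove j) + q * y b
        else y b + q * x (k.succAbove j) := by
  unfold Gam
  rw [Fin.prod_univ_succAbove _ k, Fin.prod_univ_succAbove _ k]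
  have h2 : (∏ j : Fin m, ∏ b, if k.succAbove j = b then 1 else
      if k.succAbove j < b then (if k.succAbove j = k then (Polynomial.X : Polynomial A)
        else Polynomial.C (x (k.succAbove j))) + Polynomial.C q * Polynomial.C (y b)
        else Polynomial.C (y b) + Polynomial.C q * (if k.succAbove j = k then Polynomial.X
        else Polynomial.C (x (k.succAbove j)))) = Polynomial.C (∏ j : Fin m, ∏ b,
      if k.succAbove j = b then 1 else
      if k.succAbove j < b then x (k.succAbove j) + q * y b
        else y b + q * x (k.succAbove j)) := by
    simp only [map_prod, Fin.succAbove_ne, if_false]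
    refine Finset.prod_congr rfl fun a _ => Finset.prod_congr rfl fun b _ => ?_
    split_ifs <;> simp
  rw [h2, Polynomial.coeff_mul_C]
  congr 1
  simp only [if_true, one_mul, Fin.ne_succAbove, if_false]
  have h3 := Polynomial.coeff_prod_of_natDegree_le (s := (Finset.univ : Finset (Fin m)))
    (f := fun j => if k < k.succAbove j then (Polynomial.X : Polynomial A) +
      Polynomial.C q * Polynomial.C (y (k.succAbove j)) else
      Polynomial.C (y (k.succAbove j)) + Polynomial.C q * Polynomial.X) 1 (by
        intro j _
        split_ifs
        · rw [← Polynomial.C_mul]; compute_degree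
        · compute_degree)
  simp only [Finset.card_univ, Fintype.card_fin, mul_one] at h3
  rw [h3, ← prod_pow_pos]
  refine Finset.prod_congr rfl fun j _ => ?_
  split_ifs
  · rw [← Polynomial.C_mul]; simp
  · simp [Polynomial.coeff_C]

theorem coeff_inner_ne {A : Type*} [CommRing A] (m : ℕ) (q : A) (x y : Fin (m+1) → A)
    (k l : Fin (m+1)) (hkl : k ≠ l) :
    (∏ j : Fin m, ∏ b, if k.succAbove j = b then (1 : Polynomial A) else
      if k.succAbove j < b then Polynomial.C (x (k.succAbove j)) + Polynomial.C q *
        (if b = l then Polynomial.X else Polynomial.C (y b))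
        else (if b = l then Polynomial.X else Polynomial.C (y b))
          + Polynomial.C q * Polynomial.C (x (k.succAbove j))).coeff m = 0 := by
  apply Polynomial.coeff_eq_zero_of_natDegree_lt
  refine lt_of_le_of_lt (Polynomial.natDegree_prod_le _ _) ?_
  have hb : ∀ j : Fin m, (∏ b, if k.succAbove j = b then (1 : Polynomial A) else
      if k.succAbove j < b then Polynomial.C (x (k.succAbove j)) + Polynomial.C q *
        (if b = l then Polynomial.X else Polynomial.C (y b))
        else (if b = l then Polynomial.X else Polynomial.C (y b))
          + Polynomial.C q * Polynomial.C (x (k.succAbove j))).natDegree ≤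
          if k.succAbove j = l then 0 else 1 := by
    intro j
    refine (Polynomial.natDegree_prod_le _ _).trans ?_
    have : ∀ b ∈ (Finset.univ : Finset (Fin (m+1))),
      (if k.succAbove j = b then (1 : Polynomial A) else
      if k.succAbove j < b then Polynomial.C (x (k.succAbove j)) + Polynomial.C q *
        (if b = l then Polynomial.X else Polynomial.C (y b))
        else (if b = l then Polynomial.X else Polynomial.C (y b))
          + Polynomial.C q * Polynomial.C (x (k.succAbove j))).natDegree ≤
          if b = l then (if k.succAbove j = l then 0 else 1) else 0 := by
      intro b _
      have hX : ∀ z w : A, (Polynomial.C z + Polynomial.C w * Polynomial.X).natDegree ≤ 1 := by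
        intro z w; compute_degree
      have hY : ∀ z w : A,
          (Polynomial.X + Polynomial.C w * Polynomial.C z).natDegree ≤ 1 := by
        intro z w; rw [← Polynomial.C_mul]; compute_degree
      have hZ : ∀ z w u : A,
          (Polynomial.C u + Polynomial.C w * Polynomial.C z).natDegree ≤ 0 := by
        intro z w u; rw [← Polynomial.C_mul, ← Polynomial.C_add, Polynomial.natDegree_C]
      by_cases h1 : k.succAbove j = b
      · simp [h1]
      · by_cases h2 : b = l
        · subst h2
          simp only [h1, if_true, if_false]
          split_ifs
          · exact hX _ _
          · exact hY _ _
        · simp only [h1, h2, if_false]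
          split_ifs
          · exact hZ _ _ _
          · exact hZ _ _ _
    refine (Finset.sum_le_sum this).trans ?_
    simp
  refine lt_of_le_of_lt (Finset.sum_le_sum fun j _ => hb j) ?_
  obtain ⟨j, hj⟩ := Fin.exists_succAbove_eq hkl.symm
  calc _ < ∑ j : Fin m, 1 := by
        refine Finset.sum_lt_sum (fun j _ => by split_ifs <;> simp) ⟨j, Finset.mem_univ _, ?_⟩
        simp [hj]
    _ = m := by simp

theorem coeff_inner_eq {A : Type*} [CommRing A] (m : ℕ) (q : A) (x y : Fin (m+1) → A)
    (k : Fin (m+1)) :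
    (∏ j : Fin m, ∏ b, if k.succAbove j = b then (1 : Polynomial A) else
      if k.succAbove j < b then Polynomial.C (x (k.succAbove j)) + Polynomial.C q *
        (if b = k then Polynomial.X else Polynomial.C (y b))
        else (if b = k then Polynomial.X else Polynomial.C (y b))
          + Polynomial.C q * Polynomial.C (x (k.succAbove j))).coeff m =
      q ^ (k : ℕ) * Gam m q (fun j => x (k.succAbove j)) (fun j => y (k.succAbove j)) := by
  have h1 : (∏ j : Fin m, ∏ b, if k.succAbove j = b then (1 : Polynomial A) else
      if k.succAbove j < b then Polynomial.C (x (k.succAbove j)) + Polynomial.C q *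
        (if b = k then Polynomial.X else Polynomial.C (y b))
        else (if b = k then Polynomial.X else Polynomial.C (y b))
          + Polynomial.C q * Polynomial.C (x (k.succAbove j))) =
      (∏ j : Fin m, if k < k.succAbove j then Polynomial.X + Polynomial.C q *
          Polynomial.C (x (k.succAbove j)) else
          Polynomial.C (x (k.succAbove j)) + Polynomial.C q * Polynomial.X) *
      Polynomial.C (Gam m q (fun j => x (k.succAbove j)) (fun j => y (k.succAbove j))) := by
    rw [map_Gam]
    unfold Gam
    rw [← Finset.prod_mul_distrib]
    refine Finset.prod_congr rfl fun j _ => ?_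
    rw [Fin.prod_univ_succAbove _ k]
    congr 1
    · have := Fin.succAbove_ne k j
      rcases lt_or_gt_of_ne this with h | h
      · simp [h, this, h.not_gt]
      · simp [h, this, h.not_gt]
    · refine Finset.prod_congr rfl fun b _ => ?_
      simp [Fin.succAbove_ne, Fin.succAbove_lt_succAbove_iff]
  rw [h1, Polynomial.coeff_mul_C]
  congr 1
  have h3 := Polynomial.coeff_prod_of_natDegree_le (s := (Finset.univ : Finset (Fin m)))
    (f := fun j => if k < k.succAbove j then (Polynomial.X : Polynomial A) +
      Polynomial.C q * Polynomial.C (x (k.succAbove j)) else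
      Polynomial.C (x (k.succAbove j)) + Polynomial.C q * Polynomial.X) 1 (by
        intro j _
        split_ifs
        · rw [← Polynomial.C_mul]; compute_degree
        · compute_degree)
  simp only [Finset.card_univ, Fintype.card_fin, mul_one] at h3
  rw [h3, ← prod_pow_pos]
  refine Finset.prod_congr rfl fun j _ => ?_
  split_ifs
  · rw [← Polynomial.C_mul]; simp
  · simp [Polynomial.coeff_C]

theorem coeff_coeff_Gam {A : Type*} [CommRing A] (m : ℕ) (q : A) (x y : Fin (m+1) → A)
    (k l : Fin (m+1)) :
    ((Gam (m+1) (Polynomial.C (Polynomial.C q))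
      (fun a => if a = k then Polynomial.X else Polynomial.C (Polynomial.C (x a)))
      (fun b => if b = l then Polynomial.C Polynomial.X
        else Polynomial.C (Polynomial.C (y b)))).coeff m).coeff m =
    if k = l then q ^ (2 * (k : ℕ)) *
      Gam m q (fun j => x (k.succAbove j)) (fun j => y (k.succAbove j)) else 0 := by
  have := coeff_outer m (Polynomial.C q) (fun a => Polynomial.C (x a))
    (fun b => if b = l then Polynomial.X else Polynomial.C (y b)) k
  simp only [apply_ite (Polynomial.C : Polynomial A → Polynomial (Polynomial A))] at this
  rw [this, ← map_pow, Polynomial.coeff_C_mul]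
  split_ifs with h
  · subst h
    rw [coeff_inner_eq]; ring
  · rw [coeff_inner_ne _ _ _ _ _ _ h, mul_zero]

/-- Separates out the variables `x_1` (outer) and `y_1` (inner). -/
noncomputable def Phi (m : ℕ) : PP (m+1) →ₐ[Kv] Polynomial (Polynomial (PP (m+1))) :=
  aeval (Sum.elim
    (fun i => if i = 0 then Polynomial.X else Polynomial.C (Polynomial.C (X (Sum.inl i))))
    (fun i => if i = 0 then Polynomial.C Polynomial.X
      else Polynomial.C (Polynomial.C (X (Sum.inr i)))))

theorem Phi_monomial (m : ℕ) (d : (Fin (m+1) ⊕ Fin (m+1)) →₀ ℕ) (a : Kv) :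
    Phi m (monomial d a) = Polynomial.C (Polynomial.C (monomial
      ((d.update (Sum.inl 0) 0).update (Sum.inr 0) 0) a)) *
      Polynomial.C (Polynomial.X ^ d (Sum.inr 0)) * Polynomial.X ^ d (Sum.inl 0) := by
  unfold Phi
  rw [aeval_monomial, Finsupp.prod_fintype _ _ (by simp), Fintype.prod_sum_type,
    Fin.prod_univ_succ, Fin.prod_univ_succ, monomial_eq, Finsupp.prod_fintype _ _ (by simp),
    Fintype.prod_sum_type, Fin.prod_univ_succ, Fin.prod_univ_succ]
  have : algebraMap Kv (Polynomial (Polynomial (PP (m+1)))) a =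
    Polynomial.C (Polynomial.C (C a)) := rfl
  rw [this]
  simp [Finsupp.update_apply, Fin.succ_ne_zero, map_prod]
  ring

theorem topCoeff_eq (m : ℕ) (hn : 1 ≤ m + 1) (P : PP (m+1)) :
    topCoeff (m+1) hn P = ((Phi m P).coeff m).coeff m := by
  conv_rhs => rw [P.as_sum]
  rw [map_sum, Polynomial.finsetSum_coeff, Polynomial.finsetSum_coeff]
  unfold topCoeff
  rw [Finset.sum_filter]
  refine Finset.sum_congr rfl fun d _ => ?_
  rw [Phi_monomial, ← Polynomial.C_mul, Polynomial.coeff_C_mul_X_pow]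
  change (if d (Sum.inl 0) = m + 1 - 1 ∧ d (Sum.inr 0) = m + 1 - 1 then _ else _) = _
  simp only [Nat.add_sub_cancel]
  by_cases h1 : d (Sum.inl 0) = m
  · by_cases h2 : d (Sum.inr 0) = m
    · simp [h1, h2]
    · simp [h1, h2, Ne.symm h2, Polynomial.coeff_X_pow]
  · simp [h1, Ne.symm h1]

/-- The permutation sending position `k` to `0` and the other positions via `s`. -/
def permAt {m : ℕ} (w : Fin (m+1) × Perm (Fin m)) : Perm (Fin (m+1)) :=
  Equiv.Perm.decomposeFin.symm (0, w.2) * w.1.cycleRange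

theorem permAt_self {m : ℕ} (k : Fin (m+1)) (s : Perm (Fin m)) : permAt (k, s) k = 0 := by
  simp [permAt]

theorem permAt_succAbove {m : ℕ} (k : Fin (m+1)) (s : Perm (Fin m)) (j : Fin m) :
    permAt (k, s) (k.succAbove j) = (s j).succ := by
  simp [permAt, Fin.cycleRange_succAbove]

theorem permAt_sign {m : ℕ} (k : Fin (m+1)) (s : Perm (Fin m)) :
    (Perm.sign (permAt (k, s)) : ℤ) = (-1) ^ (k : ℕ) * (Perm.sign s : ℤ) := by
  simp [permAt, Equiv.Perm.decomposeFin.symm_sign, Fin.sign_cycleRange]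
  ring

theorem permAt_bijective (m : ℕ) : Function.Bijective (permAt (m := m)) := by
  rw [Fintype.bijective_iff_injective_and_card]
  constructor
  · rintro ⟨k, s⟩ ⟨l, t⟩ h
    have hk : k = l := by
      apply (permAt (l, t)).injective
      rw [permAt_self, ← h, permAt_self]
    subst hk
    congr 1
    ext j : 1
    have h2 := permAt_succAbove k s j
    rw [h, permAt_succAbove] at h2
    exact (Fin.succ_injective _ h2).symm
  · simp [Fintype.card_perm, Nat.factorial_succ]

theorem permAt_eq_zero {m : ℕ} (k : Fin (m+1)) (s : Perm (Fin m)) (a : Fin (m+1)) :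
    permAt (k, s) a = 0 ↔ a = k := by
  rw [← permAt_self k s]
  exact (permAt (k, s)).injective.eq_iff

theorem ASymGamma_eq (n m : ℕ) (e : Fin m → Fin n) : ASymGamma n m e =
  ((m.factorial * m.factorial : Kv))⁻¹ •
    ∑ σ : Perm (Fin m), ∑ τ : Perm (Fin m),
      ((Equiv.Perm.sign σ : ℤ) * (Equiv.Perm.sign τ : ℤ)) •
        Gam m (C (RatFunc.X)⁻¹ : PP n) (fun a => X (Sum.inl (e (σ a))))
          (fun a => X (Sum.inr (e (τ a)))) := by
  unfold ASymGamma
  simp only [← Gam_eq_pairs]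

theorem Phi_term (m : ℕ) (k l : Fin (m+1)) (s t : Perm (Fin m)) :
    ((Phi m (Gam (m+1) (C (RatFunc.X)⁻¹ : PP (m+1)) (fun a => X (Sum.inl (permAt (k, s) a)))
      (fun a => X (Sum.inr (permAt (l, t) a))))).coeff m).coeff m =
    if k = l then (C (RatFunc.X)⁻¹ : PP (m+1)) ^ (2 * (k : ℕ)) *
      Gam m (C (RatFunc.X)⁻¹) (fun j => X (Sum.inl (s j).succ))
        (fun j => X (Sum.inr (t j).succ)) else 0 := by
  have h := map_Gam (B := Polynomial (Polynomial (PP (m+1)))) (Phi m).toRingHom (m+1) (C (RatFunc.X)⁻¹ : PP (m+1))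
    (fun a => X (Sum.inl (permAt (k, s) a))) (fun a => X (Sum.inr (permAt (l, t) a)))
  have hC : Phi m (C (RatFunc.X)⁻¹) = Polynomial.C (Polynomial.C (C (RatFunc.X)⁻¹)) := by
    unfold Phi; rw [aeval_C]; rfl
  have hx : ∀ i, Phi m (X (Sum.inl i)) =
      if i = 0 then Polynomial.X else Polynomial.C (Polynomial.C (X (Sum.inl i))) := by
    intro i; unfold Phi; rw [aeval_X]; rfl
  have hy : ∀ i, Phi m (X (Sum.inr i)) =
      if i = 0 then Polynomial.C Polynomial.X
        else Polynomial.C (Polynomial.C (X (Sum.inr i))) := by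
    intro i; unfold Phi; rw [aeval_X]; rfl
  simp only [AlgHom.toRingHom_eq_coe, RingHom.coe_coe, hC, hx, hy, permAt_eq_zero] at h
  rw [h, coeff_coeff_Gam m (C (RatFunc.X)⁻¹ : PP (m+1))
    (fun a => X (Sum.inl (permAt (k, s) a))) (fun a => X (Sum.inr (permAt (l, t) a)))]
  split_ifs with hkl
  · subst hkl
    simp only [permAt_succAbove]
  · rfl

theorem ratX_pow_ne {N : ℕ} (hN : 0 < N) : (RatFunc.X : Kv) ^ N ≠ 1 := by
  rw [← RatFunc.algebraMap_X, ← map_pow, ← map_one (algebraMap (Polynomial ℂ) Kv)]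
  intro h
  have h2 := RatFunc.algebraMap_injective ℂ h
  have h3 := congrArg Polynomial.natDegree h2
  simp at h3
  omega

theorem kappa_eq (m : ℕ) : ((m+1 : ℕ) : Kv) ^ 2 *
    ((1 - RatFunc.X ^ (-(2 * ((m+1 : ℕ) : ℤ)))) /
          (((m+1 : ℕ) : Kv) ^ 2 * (1 - RatFunc.X ^ (-2 : ℤ)))) =
    ∑ k : Fin (m+1), ((RatFunc.X : Kv)⁻¹) ^ (2 * (k : ℕ)) := by
  have h0 : ((m+1 : ℕ) : Kv) ≠ 0 := Nat.cast_ne_zero.mpr (by omega)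
  have e1 : (RatFunc.X : Kv) ^ (-(2 * ((m+1 : ℕ) : ℤ))) = (((RatFunc.X : Kv)⁻¹) ^ 2) ^ (m+1) := by
    rw [← pow_mul, inv_pow, zpow_neg]
    congr 1
  have e2 : (RatFunc.X : Kv) ^ (-2 : ℤ) = ((RatFunc.X : Kv)⁻¹) ^ 2 := by
    rw [inv_pow, zpow_neg]; norm_cast
  have h1 : 1 - ((RatFunc.X : Kv)⁻¹) ^ 2 ≠ 0 := by
    rw [sub_ne_zero, inv_pow]
    intro h
    exact ratX_pow_ne (N := 2) (by norm_num) (inv_eq_one.mp h.symm)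
  rw [e1, e2, Fin.sum_univ_eq_sum_range (fun k => ((RatFunc.X : Kv)⁻¹) ^ (2 * k))]
  simp only [pow_mul]
  have := geom_sum_mul_neg (((RatFunc.X : Kv)⁻¹) ^ 2) (m+1)
  rw [← this, mul_div_assoc']
  rw [div_eq_iff (mul_ne_zero (pow_ne_zero _ h0) h1)]
  ring

theorem kappa_ne (m : ℕ) : ((1 - RatFunc.X ^ (-(2 * ((m+1 : ℕ) : ℤ)))) /
          (((m+1 : ℕ) : Kv) ^ 2 * (1 - RatFunc.X ^ (-2 : ℤ)))) ≠ 0 := by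
  have h0 : ((m+1 : ℕ) : Kv) ≠ 0 := Nat.cast_ne_zero.mpr (by omega)
  have key : ∀ N : ℕ, 0 < N → (1 : Kv) - RatFunc.X ^ (-(N : ℤ)) ≠ 0 := by
    intro N hN
    rw [sub_ne_zero, zpow_neg, zpow_natCast]
    intro h
    exact ratX_pow_ne hN (inv_eq_one.mp h.symm)
  refine div_ne_zero ?_ (mul_ne_zero (pow_ne_zero _ h0) ?_)
  · exact_mod_cast key (2 * (m+1)) (by omega)
  · exact_mod_cast key 2 (by omega)

theorem part2 (m : ℕ) (hn : 1 ≤ m + 1) :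
    topCoeff (m+1) hn (ASymGamma (m+1) (m+1) id) =
      C ((1 - RatFunc.X ^ (-(2 * ((m+1 : ℕ) : ℤ)))) /
          (((m+1 : ℕ) : Kv) ^ 2 * (1 - RatFunc.X ^ (-2 : ℤ)))) *
        ASymGamma (m+1) m Fin.succ := by
  set κ : Kv := ((1 - RatFunc.X ^ (-(2 * ((m+1 : ℕ) : ℤ)))) /
          (((m+1 : ℕ) : Kv) ^ 2 * (1 - RatFunc.X ^ (-2 : ℤ)))) with hκ
  have hk := kappa_eq m
  rw [← hκ] at hk
  rw [topCoeff_eq, ASymGamma_eq, ASymGamma_eq]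
  set S : PP (m+1) := ∑ σ : Perm (Fin m), ∑ τ : Perm (Fin m),
      ((Equiv.Perm.sign σ : ℤ) * (Equiv.Perm.sign τ : ℤ)) •
        Gam m (C (RatFunc.X)⁻¹ : PP (m+1)) (fun a => X (Sum.inl (σ a).succ))
          (fun a => X (Sum.inr (τ a).succ)) with hS
  have main : ((Phi m (∑ σ : Perm (Fin (m+1)), ∑ τ : Perm (Fin (m+1)),
      ((Equiv.Perm.sign σ : ℤ) * (Equiv.Perm.sign τ : ℤ)) •
        Gam (m+1) (C (RatFunc.X)⁻¹ : PP (m+1)) (fun a => X (Sum.inl (id (σ a))))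
          (fun a => X (Sum.inr (id (τ a)))))).coeff m).coeff m =
      C (∑ k : Fin (m+1), ((RatFunc.X : Kv)⁻¹) ^ (2 * (k : ℕ))) * S := by
    simp only [map_sum, map_zsmul, Polynomial.finsetSum_coeff, Polynomial.coeff_smul, id]
    rw [← (permAt_bijective m).sum_comp, Fintype.sum_prod_type, Finset.sum_mul]
    refine Finset.sum_congr rfl fun k _ => ?_
    rw [hS, Finset.mul_sum]
    refine Finset.sum_congr rfl fun s _ => ?_
    rw [← (permAt_bijective m).sum_comp, Fintype.sum_prod_type]
    simp only [Phi_term, smul_ite, smul_zero]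
    rw [Finset.sum_eq_single k]
    · rw [Finset.mul_sum]
      refine Finset.sum_congr rfl fun t _ => ?_
      rw [if_pos rfl, permAt_sign, permAt_sign]
      have : ((-1 : ℤ) ^ (k : ℕ) * (Perm.sign s : ℤ) * ((-1) ^ (k : ℕ) * (Perm.sign t : ℤ)))
        = (Perm.sign s : ℤ) * (Perm.sign t : ℤ) := by
        have : ((-1 : ℤ) ^ (k : ℕ)) * (-1) ^ (k : ℕ) = 1 := by
          rw [← mul_pow]; simp
        linear_combination ((Perm.sign s : ℤ) * (Perm.sign t : ℤ)) * this
      rw [this, map_pow, mul_smul_comm]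
    · intro l _ hl
      simp [hl.symm]
    · simp
  rw [map_smul, Polynomial.coeff_smul, Polynomial.coeff_smul, main, ← hk]
  rw [smul_eq_C_mul, smul_eq_C_mul, ← mul_assoc, ← mul_assoc, ← C_mul, ← C_mul]
  congr 2
  have h0 : ((m+1 : ℕ) : Kv) ≠ 0 := Nat.cast_ne_zero.mpr (by omega)
  have h1 : ((m.factorial : ℕ) : Kv) ≠ 0 := Nat.cast_ne_zero.mpr (Nat.factorial_ne_zero _)
  rw [Nat.factorial_succ, Nat.cast_mul]
  clear_value κ
  field_simp

theorem det_alt {A : Type*} [CommRing A] (n : ℕ) (x : Fin n → A) (α : Fin n → ℕ)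
    (h : ∀ j, α j < n) : ∃ c : ℤ, (Matrix.of fun i j => x i ^ α j).det =
      (c : A) * ∏ p ∈ pairs n, (x p.1 - x p.2) := by
  by_cases hi : Function.Injective α
  · have hb : Function.Bijective (fun j => (⟨α j, h j⟩ : Fin n)) :=
      Finite.injective_iff_bijective.mp fun a b hab => hi (Fin.mk.inj_iff.mp hab)
    let π : Perm (Fin n) := Equiv.ofBijective _ hb
    have hM : (Matrix.of fun i j => x i ^ α j) = (Matrix.vandermonde x).submatrix id π := by
      ext i j; simp [Matrix.vandermonde, π]
    have hV : (Matrix.vandermonde x).det =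
        (-1) ^ (pairs n).card * ∏ p ∈ pairs n, (x p.1 - x p.2) := by
      rw [Matrix.det_vandermonde, ← Finset.prod_const, ← Finset.prod_mul_distrib]
      unfold pairs
      simp only [Finset.prod_filter, ← Finset.univ_product_univ, Finset.prod_product]
      refine Finset.prod_congr rfl fun i _ => ?_
      rw [← Finset.prod_filter]
      refine Finset.prod_congr ?_ fun j _ => by ring
      ext; simp
    refine ⟨(Perm.sign π : ℤ) * (-1) ^ (pairs n).card, ?_⟩
    rw [hM, Matrix.det_permute', hV]
    push_cast
    ring
  · rw [Function.not_injective_iff] at hi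
    obtain ⟨a, b, hab, hne⟩ := hi
    refine ⟨0, ?_⟩
    rw [Matrix.det_zero_of_column_eq hne (by intro k; simp [hab])]
    simp

theorem degree_bound (n : ℕ) (q : Kv) (d : (Fin n ⊕ Fin n) →₀ ℕ)
    (hd : d ∈ (Gam n (C q : PP n) (fun a => X (Sum.inl a)) (fun a => X (Sum.inr a))).support)
    (z : Fin n) : d (Sum.inl z) < n ∧ d (Sum.inr z) < n := by
  have hX : ∀ u v w : Fin n ⊕ Fin n, degreeOf u (X v + C q * X w : PP n) ≤
      max (if u = v then 1 else 0) (if u = w then 1 else 0) := by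
    intro u v w
    refine (degreeOf_add_le _ _ _).trans (max_le_max ?_ ?_)
    · rw [degreeOf_X]
    · refine (degreeOf_C_mul_le _ _ _).trans ?_
      rw [degreeOf_X]
  constructor
  · refine lt_of_le_of_lt (monomial_le_degreeOf (Sum.inl z) hd) ?_
    unfold Gam
    refine lt_of_le_of_lt (degreeOf_prod_le _ _ _) ?_
    refine lt_of_le_of_lt (Finset.sum_le_sum fun a _ => degreeOf_prod_le _ _ _) ?_
    refine lt_of_le_of_lt (b := ∑ a : Fin n, ∑ b : Fin n,
      if a = z then (if b = z then 0 else 1) else 0) ?_ ?_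
    · refine Finset.sum_le_sum fun a _ => Finset.sum_le_sum fun b _ => ?_
      by_cases h1 : a = b
      · simp [h1, degreeOf_one]
      · simp only [h1, if_false]
        have h3 := hX (Sum.inl z) (Sum.inl a) (Sum.inr b)
        have h4 := hX (Sum.inl z) (Sum.inr b) (Sum.inl a)
        simp only [Sum.inl.injEq, reduceCtorEq, if_false] at h3 h4
        split_ifs at * <;> omega
    · rw [Finset.sum_comm]
      simp only [Finset.sum_ite_eq', Finset.mem_univ, if_true]
      calc _ < ∑ j : Fin n, 1 := by
            refine Finset.sum_lt_sum (fun j _ => by split_ifs <;> simp)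
              ⟨z, Finset.mem_univ _, by simp⟩
        _ = n := by simp
  · refine lt_of_le_of_lt (monomial_le_degreeOf (Sum.inr z) hd) ?_
    unfold Gam
    refine lt_of_le_of_lt (degreeOf_prod_le _ _ _) ?_
    refine lt_of_le_of_lt (Finset.sum_le_sum fun a _ => degreeOf_prod_le _ _ _) ?_
    refine lt_of_le_of_lt (b := ∑ a : Fin n, ∑ b : Fin n,
      if b = z then (if a = z then 0 else 1) else 0) ?_ ?_
    · refine Finset.sum_le_sum fun a _ => Finset.sum_le_sum fun b _ => ?_
      by_cases h1 : a = b
      · simp [h1, degreeOf_one]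
      · simp only [h1, if_false]
        have h3 := hX (Sum.inr z) (Sum.inl a) (Sum.inr b)
        have h4 := hX (Sum.inr z) (Sum.inr b) (Sum.inl a)
        simp only [Sum.inr.injEq, reduceCtorEq, if_false] at h3 h4
        split_ifs at * <;> omega
    · simp only [Finset.sum_ite_eq', Finset.mem_univ, if_true]
      calc _ < ∑ j : Fin n, 1 := by
            refine Finset.sum_lt_sum (fun j _ => by split_ifs <;> simp)
              ⟨z, Finset.mem_univ _, by simp⟩
        _ = n := by simp

theorem part1 (n : ℕ) : ∃ c : Kv, ASymGamma n n id =
        C c * ((∏ p ∈ pairs n, (X (Sum.inl p.1) - X (Sum.inl p.2))) *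
               ∏ p ∈ pairs n, (X (Sum.inr p.1) - X (Sum.inr p.2))) := by
  set V : PP n := ((∏ p ∈ pairs n, (X (Sum.inl p.1) - X (Sum.inl p.2))) *
               ∏ p ∈ pairs n, (X (Sum.inr p.1) - X (Sum.inr p.2))) with hV
  rw [ASymGamma_eq]
  suffices h : ∃ c : Kv, ∑ σ : Perm (Fin n), ∑ τ : Perm (Fin n),
      ((Equiv.Perm.sign σ : ℤ) * (Equiv.Perm.sign τ : ℤ)) •
        Gam n (C (RatFunc.X)⁻¹ : PP n) (fun a => X (Sum.inl (id (σ a))))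
          (fun a => X (Sum.inr (id (τ a)))) = C c * V by
    obtain ⟨c, hc⟩ := h
    refine ⟨((n.factorial * n.factorial : Kv))⁻¹ * c, ?_⟩
    rw [hc, smul_eq_C_mul, C_mul, mul_assoc]
  set G : PP n := Gam n (C (RatFunc.X)⁻¹ : PP n) (fun a => X (Sum.inl a))
    (fun a => X (Sum.inr a)) with hG
  have hr : ∀ σ τ : Perm (Fin n), Gam n (C (RatFunc.X)⁻¹ : PP n)
      (fun a => X (Sum.inl (id (σ a)))) (fun a => X (Sum.inr (id (τ a)))) =
      ∑ d ∈ G.support, C (G.coeff d) * ((∏ a, X (Sum.inl (σ a)) ^ d (Sum.inl a)) *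
        ∏ a, X (Sum.inr (τ a)) ^ d (Sum.inr a)) := by
    intro σ τ
    have h := map_Gam (rename (R := Kv) (Sum.map σ τ)).toRingHom n (C (RatFunc.X)⁻¹ : PP n)
      (fun a => X (Sum.inl a)) (fun a => X (Sum.inr a))
    simp only [AlgHom.toRingHom_eq_coe, RingHom.coe_coe, rename_C, rename_X, Sum.map_inl,
      Sum.map_inr] at h
    simp only [id]
    rw [← h, ← hG]
    conv_lhs => rw [G.as_sum]
    rw [map_sum]
    refine Finset.sum_congr rfl fun d _ => ?_
    rw [monomial_eq, map_mul, rename_C, Finsupp.prod_fintype _ _ (by simp),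
      Fintype.prod_sum_type]
    simp [map_prod]
  have hsum : ∑ σ : Perm (Fin n), ∑ τ : Perm (Fin n),
      ((Equiv.Perm.sign σ : ℤ) * (Equiv.Perm.sign τ : ℤ)) •
        Gam n (C (RatFunc.X)⁻¹ : PP n) (fun a => X (Sum.inl (id (σ a))))
          (fun a => X (Sum.inr (id (τ a)))) =
      ∑ d ∈ G.support, C (G.coeff d) *
        ((Matrix.of fun i j => (X (Sum.inl i) : PP n) ^ d (Sum.inl j)).det *
        (Matrix.of fun i j => (X (Sum.inr i) : PP n) ^ d (Sum.inr j)).det) := by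
    simp only [hr, Finset.smul_sum]
    rw [Finset.sum_congr rfl fun σ _ => Finset.sum_comm, Finset.sum_comm]
    refine Finset.sum_congr rfl fun d _ => ?_
    rw [Matrix.det_apply, Matrix.det_apply, Finset.sum_mul_sum, Finset.mul_sum]
    refine Finset.sum_congr rfl fun σ _ => ?_
    rw [Finset.mul_sum]
    refine Finset.sum_congr rfl fun τ _ => ?_
    simp only [Units.smul_def, zsmul_eq_mul, Matrix.of_apply]
    push_cast
    ring
  rw [hsum]
  refine Finset.sum_induction _ (fun S => ∃ c : Kv, S = C c * V) ?_ ⟨0, by simp⟩ ?_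
  · rintro _ _ ⟨a, rfl⟩ ⟨b, rfl⟩
    exact ⟨a + b, by rw [C_add, add_mul]⟩
  · intro d hd
    obtain ⟨c1, h1⟩ := det_alt n (fun i => (X (Sum.inl i) : PP n)) (fun j => d (Sum.inl j))
      (fun j => (degree_bound n _ d hd j).1)
    obtain ⟨c2, h2⟩ := det_alt n (fun i => (X (Sum.inr i) : PP n)) (fun j => d (Sum.inr j))
      (fun j => (degree_bound n _ d hd j).2)
    refine ⟨G.coeff d * c1 * c2, ?_⟩
    rw [h1, h2, hV]
    simp only [C_mul, map_intCast]
    ring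

theorem ASym_rename (n m : ℕ) (e : Fin m → Fin n) :
    ASymGamma n m e = rename (Sum.map e e) (ASymGamma m m id) := by
  unfold ASymGamma
  simp [map_sum, map_prod, smul_eq_C_mul]

theorem ASym_ne_zero (n : ℕ) : ASymGamma n n id ≠ 0 := by
  induction n with
  | zero => simp [ASymGamma, pairs]
  | succ m ih =>
    intro h
    have h2 := part2 m (by omega)
    rw [h] at h2
    have h3 : topCoeff (m+1) (by omega) (0 : PP (m+1)) = 0 := by simp [topCoeff]
    rw [h3] at h2
    have h4 := (mul_eq_zero.mp h2.symm).resolve_left (by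
      rw [C_eq_zero]; exact kappa_ne m)
    rw [ASym_rename] at h4
    have hinj : Function.Injective (Sum.map (Fin.succ (n := m)) (Fin.succ (n := m))) :=
      Function.Injective.sumMap (Fin.succ_injective _) (Fin.succ_injective _)
    exact ih (rename_injective _ hinj (by rw [h4, map_zero]))

/-- `ASym_{S_n × S_n}(Γ_n)` is a nonzero ℂ(v)-multiple of
`∏_{i<j}(x_i - x_j) ∏_{i<j}(y_i - y_j)` (in particular nonzero), and the coefficient of
`x_1^{n-1} y_1^{n-1}` in it equals `(1 - v^{-2n})/(n²(1 - v^{-2}))` times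
`ASym_{S_{n-1} × S_{n-1}}(Γ_{n-1}(x_2,…,x_n,y_2,…,y_n))`. -/
theorem stmt13 (n : ℕ) (hn : 1 ≤ n) :
    (∃ c : Kv, c ≠ 0 ∧
      ASymGamma n n id =
        C c * ((∏ p ∈ pairs n, (X (Sum.inl p.1) - X (Sum.inl p.2))) *
               ∏ p ∈ pairs n, (X (Sum.inr p.1) - X (Sum.inr p.2)))) ∧
    topCoeff n hn (ASymGamma n n id) =
      C ((1 - RatFunc.X ^ (-(2 * (n : ℤ)))) /
          ((n : Kv) ^ 2 * (1 - RatFunc.X ^ (-2 : ℤ)))) *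
        ASymGamma n (n - 1) (fun i => ⟨(i : ℕ) + 1, by omega⟩) := by
  obtain ⟨m, rfl⟩ : ∃ m, n = m + 1 := ⟨n - 1, by omega⟩
  refine ⟨?_, part2 m hn⟩
  obtain ⟨c, hc⟩ := part1 (m+1)
  refine ⟨c, ?_, hc⟩
  rintro rfl
  apply ASym_ne_zero (m+1)
  rw [hc, C_0, zero_mul]
end

section
/- Let S = ⊕_k C(v)[x_1^{±1},...,x_k^{±1}]^{S_k} with the shuffle product F ⋆ G = Sym_{S_{k+l}}( F(x_1,...,x_k) G(x_{k+1},...,x_{k+l}) ∏_{i<=k<j} (x_i - v x_j)/(x_i - x_j) ). Then ⋆ is associative, and for any partition lambda = (lambda_1 >= ... >= lambda_n) one has x^{lambda_1} ⋆ x^{lambda_2} ⋆ ... ⋆ x^{lambda_n} = Sym_{S_n}( x_1^{lambda_1} ... x_n^{lambda_n} ∏_{i<j} (x_i - v x_j)/(x_i - x_j) ), the Hall–Littlewood Laurent polynomial P_lambda(x; v). -/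
set_option synthInstance.maxHeartbeats 1000000
set_option maxHeartbeats 1000000

open MvPolynomial Equiv

/-- The field of rational functions in `x_1, …, x_n` over ℂ(v), in which the
symmetric Laurent polynomials `S_n` live. -/
noncomputable abbrev FF (n : ℕ) : Type := FractionRing (MvPolynomial (Fin n) Kv)

noncomputable def xv {n : ℕ} (i : Fin n) : FF n :=
  algebraMap (MvPolynomial (Fin n) Kv) (FF n) (X i)

noncomputable def vF {n : ℕ} : FF n :=
  algebraMap (MvPolynomial (Fin n) Kv) (FF n) (C RatFunc.X)

/-- The field embedding `FF k →+* FF n` induced by an injective map `e : Fin k → Fin n`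
(substitution of variables `x_i ↦ x_{e(i)}`). -/
noncomputable def embFF {k n : ℕ} (e : Fin k → Fin n) (he : Function.Injective e) :
    FF k →+* FF n :=
  IsFractionRing.lift (g := (algebraMap (MvPolynomial (Fin n) Kv) (FF n)).comp
      (rename e).toRingHom)
    (by
      have h1 : Function.Injective (algebraMap (MvPolynomial (Fin n) Kv) (FF n)) :=
        IsFractionRing.injective _ _
      have h2 := rename_injective (R := Kv) e he
      exact fun a b hab => h2 (h1 (by simpa using hab)))

/-- The symmetrization operator `Sym_{S_n}` on rational functions:
`(1/n!) ∑_{σ ∈ S_n} σ·P`. -/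
noncomputable def symmize (n : ℕ) (P : FF n) : FF n :=
  (n.factorial : FF n)⁻¹ * ∑ σ : Perm (Fin n), embFF σ (σ.injective) P

/-- A rational function symmetric in its `n` variables. -/
def SymmRF {n : ℕ} (P : FF n) : Prop := ∀ σ : Perm (Fin n), embFF σ (σ.injective) P = P

/-- The shuffle kernel `∏_{i ≤ k < j} (x_i - v x_j)/(x_i - x_j)` in `n` variables. -/
noncomputable def shufKer (k n : ℕ) : FF n :=
  ∏ p ∈ Finset.univ.filter (fun p : Fin n × Fin n => (p.1 : ℕ) < k ∧ k ≤ (p.2 : ℕ)),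
    (xv p.1 - vF * xv p.2) / (xv p.1 - xv p.2)

/-- The shuffle product `F ⋆ G = Sym_{S_{k+l}}(F(x_1,…,x_k) G(x_{k+1},…,x_{k+l}) ·
∏_{i ≤ k < j} (x_i - v x_j)/(x_i - x_j))`. -/
noncomputable def shuf (k l : ℕ) (F : FF k) (G : FF l) : FF (k + l) :=
  symmize (k + l)
    (embFF (Fin.castAddEmb l) (Fin.castAddEmb l).injective F *
     embFF (Fin.natAddEmb k) (Fin.natAddEmb k).injective G * shufKer k (k + l))

/-- Transport along an equality of the number of variables. -/
noncomputable def castFF {n n' : ℕ} (h : n = n') : FF n →+* FF n' :=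
  embFF (finCongr h) (finCongr h).injective

/-- The iterated shuffle product `x^{λ 0} ⋆ x^{λ 1} ⋆ ⋯ ⋆ x^{λ (n-1)}` of the
one-variable Laurent monomials `x^{λ i}`. -/
noncomputable def monProd : (n : ℕ) → (Fin n → ℤ) → FF n
  | 0, _ => 1
  | (m + 1), l =>
      castFF (Nat.add_comm 1 m)
        (shuf 1 m (xv (0 : Fin 1) ^ (l 0)) (monProd m (fun i => l i.succ)))

theorem embFF_algebraMap {k n : ℕ} (e : Fin k → Fin n) (he : Function.Injective e)
    (p : MvPolynomial (Fin k) Kv) :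
    embFF e he (algebraMap (MvPolynomial (Fin k) Kv) (FF k) p) =
      algebraMap (MvPolynomial (Fin n) Kv) (FF n) (rename e p) := by
  exact IsFractionRing.lift_algebraMap _ p

theorem embFF_xv {k n : ℕ} (e : Fin k → Fin n) (he : Function.Injective e) (i : Fin k) :
    embFF e he (xv i) = xv (e i) := by
  unfold xv
  rw [embFF_algebraMap, rename_X]

theorem embFF_vF {k n : ℕ} (e : Fin k → Fin n) (he : Function.Injective e) :
    embFF e he vF = vF := by
  unfold vF
  rw [embFF_algebraMap, rename_C]

theorem embFF_embFF {k n m : ℕ} (e : Fin k → Fin n) (he : Function.Injective e)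
    (f : Fin n → Fin m) (hf : Function.Injective f) (P : FF k) :
    embFF f hf (embFF e he P) = embFF (f ∘ e) (hf.comp he) P := by
  have : (embFF f hf).comp (embFF e he) = embFF (f ∘ e) (hf.comp he) := by
    apply IsLocalization.ringHom_ext (nonZeroDivisors (MvPolynomial (Fin k) Kv))
    refine RingHom.ext fun p => ?_
    simp only [RingHom.comp_apply, embFF_algebraMap, rename_rename]
  exact RingHom.congr_fun this P

theorem embFF_id {k : ℕ} (e : Fin k → Fin k) (he : Function.Injective e)
    (h : e = id) (P : FF k) : embFF e he P = P := by
  subst h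
  have : embFF id he = RingHom.id (FF k) := by
    apply IsLocalization.ringHom_ext (nonZeroDivisors (MvPolynomial (Fin k) Kv))
    refine RingHom.ext fun p => ?_
    simp only [RingHom.comp_apply, embFF_algebraMap, rename_id, RingHom.id_apply,
      AlgHom.id_apply, id]
  exact RingHom.congr_fun this P

theorem embFF_congr {k n : ℕ} {e f : Fin k → Fin n} (he : Function.Injective e)
    (hf : Function.Injective f) (h : e = f) (P : FF k) :
    embFF e he P = embFF f hf P := by
  subst h; rfl

theorem charZero_FF (n : ℕ) : CharZero (FF n) := by
  have h1 : CharZero Kv := charZero_of_injective_algebraMap (algebraMap ℂ Kv).injective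
  have h2 : Function.Injective
      ((algebraMap (MvPolynomial (Fin n) Kv) (FF n)).comp (C : Kv →+* MvPolynomial (Fin n) Kv)) :=
    RingHom.injective _
  exact charZero_of_injective_ringHom h2

theorem fact_ne_zero (n k : ℕ) : (k.factorial : FF n) ≠ 0 := by
  have := charZero_FF n
  exact Nat.cast_ne_zero.mpr (Nat.factorial_ne_zero k)

theorem symmize_emb {n : ℕ} (τ : Perm (Fin n)) (P : FF n) :
    symmize n (embFF τ τ.injective P) = symmize n P := by
  unfold symmize
  congr 1
  rw [← Equiv.sum_comp (Equiv.mulRight τ) (fun σ : Perm (Fin n) => embFF σ σ.injective P)]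
  refine Finset.sum_congr rfl fun σ _ => ?_
  rw [embFF_embFF]
  rfl

theorem symmize_sum {n : ℕ} {ι : Type} (s : Finset ι) (f : ι → FF n) :
    symmize n (∑ i ∈ s, f i) = ∑ i ∈ s, symmize n (f i) := by
  unfold symmize
  simp only [map_sum]
  rw [Finset.sum_comm, Finset.mul_sum]

theorem symmize_natInv_mul {n : ℕ} (c : ℕ) (P : FF n) :
    symmize n ((c : FF n)⁻¹ * P) = (c : FF n)⁻¹ * symmize n P := by
  unfold symmize
  simp only [map_mul, map_inv₀, map_natCast]
  rw [← Finset.mul_sum, mul_left_comm]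

theorem symm_absorb {k n : ℕ} (e : Fin k ↪ Fin n) (P : FF k) (R : FF n)
    (hR : ∀ σ : Perm (Fin n), (∀ x, x ∉ Set.range e → σ x = x) →
      embFF σ σ.injective R = R) :
    symmize n (embFF e e.injective (symmize k P) * R) =
      symmize n (embFF e e.injective P * R) := by
  have h1 : embFF e e.injective (symmize k P) * R =
      (k.factorial : FF n)⁻¹ * ∑ τ : Perm (Fin k),
        embFF (τ.viaFintypeEmbedding e) (τ.viaFintypeEmbedding e).injective
          (embFF e e.injective P * R) := by
    rw [symmize]
    simp only [map_mul, map_inv₀, map_natCast, map_sum]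
    rw [mul_assoc, Finset.sum_mul]
    congr 1
    refine Finset.sum_congr rfl fun τ _ => ?_
    rw [hR _ (fun x hx => Equiv.Perm.viaFintypeEmbedding_apply_notMem_range _ _ hx)]
    rw [embFF_embFF, embFF_embFF]
    congr 1
    apply embFF_congr
    funext a
    simp only [Function.comp_apply, Equiv.Perm.viaFintypeEmbedding_apply_image]
  rw [h1, symmize_natInv_mul, symmize_sum]
  simp only [symmize_emb]
  rw [Finset.sum_const, Finset.card_univ, Fintype.card_perm, Fintype.card_fin, nsmul_eq_mul,
    inv_mul_cancel_left₀ (fact_ne_zero n k)]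

theorem cast_symmize {n n' : ℕ} (h : n = n') (P : FF n) :
    castFF h (symmize n P) = symmize n' (castFF h P) := by
  subst h
  unfold castFF
  rw [embFF_id _ _ (by ext; simp), embFF_id _ _ (by ext; simp)]

/-- Product of kernel factors over a set of pairs. -/
noncomputable def KK {n : ℕ} (S : Finset (Fin n × Fin n)) : FF n :=
  ∏ p ∈ S, (xv p.1 - vF * xv p.2) / (xv p.1 - xv p.2)

theorem embFF_KK {k n : ℕ} (e : Fin k → Fin n) (he : Function.Injective e)
    (S : Finset (Fin k × Fin k)) (T : Finset (Fin n × Fin n))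
    (h1 : ∀ a b, (a, b) ∈ S ↔ (e a, e b) ∈ T)
    (h2 : ∀ c d, (c, d) ∈ T → (∃ a, e a = c) ∧ ∃ b, e b = d) :
    embFF e he (KK S) = KK T := by
  unfold KK
  rw [map_prod]
  refine Finset.prod_nbij (fun p => (e p.1, e p.2)) ?_ ?_ ?_ ?_
  · rintro ⟨a, b⟩ h
    exact (h1 a b).1 h
  · rintro ⟨a, b⟩ _ ⟨c, d⟩ _ h
    have h' := Prod.mk.inj h
    exact Prod.ext (he h'.1) (he h'.2)
  · rintro ⟨c, d⟩ h
    obtain ⟨⟨a, rfl⟩, ⟨b, rfl⟩⟩ := h2 c d h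
    exact ⟨(a, b), (h1 a b).2 h, rfl⟩
  · rintro ⟨a, b⟩ _
    simp only [map_div₀, map_sub, map_mul, embFF_xv, embFF_vF]

theorem KK_mul {n : ℕ} (S T U : Finset (Fin n × Fin n))
    (h1 : ∀ p, p ∈ S → p ∉ T) (h2 : ∀ p, p ∈ U ↔ p ∈ S ∨ p ∈ T) : KK S * KK T = KK U := by
  have hU : U = S ∪ T := by
    ext p; simp [h2]
  rw [hU]
  unfold KK
  rw [Finset.prod_union (Finset.disjoint_left.2 h1)]

theorem shufKer_eq (k n : ℕ) : shufKer k n =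
    KK (Finset.univ.filter (fun p : Fin n × Fin n => (p.1 : ℕ) < k ∧ k ≤ (p.2 : ℕ))) := rfl

theorem shufKer_inv {k n : ℕ} (σ : Perm (Fin n)) (h : ∀ x, (σ x : ℕ) < k ↔ (x : ℕ) < k) :
    embFF σ σ.injective (shufKer k n) = shufKer k n := by
  rw [shufKer_eq]
  apply embFF_KK
  · intro a b
    have h1 := h a
    have h2 := h b
    simp only [Finset.mem_filter, Finset.mem_univ, true_and]
    omega
  · intro c d _
    exact ⟨σ.surjective c, σ.surjective d⟩

/-- A permutation fixing everything outside a predicate preserves the predicate. -/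
theorem perm_pres {α : Type} (σ : Perm α) (p : α → Prop) (h : ∀ x, ¬ p x → σ x = x) (x : α) :
    p (σ x) ↔ p x := by
  constructor
  · intro hx
    by_contra hn
    rw [h x hn] at hx
    exact hn hx
  · intro hx
    by_contra hn
    have h1 := σ.injective (h (σ x) hn)
    rw [h1] at hn
    exact hn hx

theorem shuf_symm_left (k l : ℕ) (P : FF k) (G : FF l) :
    shuf k l (symmize k P) G = shuf k l P G := by
  unfold shuf
  rw [mul_assoc, mul_assoc]
  apply symm_absorb
  intro σ hσ
  have hσ' : ∀ x : Fin (k + l), ¬ ((x : ℕ) < k) → σ x = x := by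
    intro x hx
    apply hσ
    rintro ⟨a, rfl⟩
    exact hx (by simp)
  rw [map_mul, shufKer_inv σ (perm_pres σ (fun x => (x : ℕ) < k) hσ'), embFF_embFF]
  congr 1
  apply embFF_congr
  funext a
  exact hσ' _ (by simp)

theorem shuf_symm_right (k l : ℕ) (F : FF k) (Q : FF l) :
    shuf k l F (symmize l Q) = shuf k l F Q := by
  unfold shuf
  rw [mul_comm (embFF (Fin.castAddEmb l) _ F) (embFF (Fin.natAddEmb k) _ (symmize l Q)), mul_assoc,
    mul_comm (embFF (Fin.castAddEmb l) _ F) (embFF (Fin.natAddEmb k) _ Q), mul_assoc]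
  apply symm_absorb
  intro σ hσ
  have hσ' : ∀ x : Fin (k + l), ¬ (k ≤ (x : ℕ)) → σ x = x := by
    intro x hx
    apply hσ
    rintro ⟨a, rfl⟩
    exact hx (by simp)
  have h2 := perm_pres σ (fun x => k ≤ (x : ℕ)) hσ'
  rw [map_mul, shufKer_inv σ (fun x => by have := h2 x; omega), embFF_embFF]
  congr 1
  apply embFF_congr
  funext a
  exact hσ' _ (by simp)

theorem shuf_assoc (k l m : ℕ) (F : FF k) (G : FF l) (H : FF m) :
    shuf (k + l) m (shuf k l F G) H =
      castFF (Nat.add_assoc k l m).symm (shuf k (l + m) F (shuf l m G H)) := by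
  have e1 : shuf k l F G = symmize (k + l)
    (embFF (Fin.castAddEmb l) (Fin.castAddEmb l).injective F *
     embFF (Fin.natAddEmb k) (Fin.natAddEmb k).injective G * shufKer k (k + l)) := rfl
  have e2 : shuf l m G H = symmize (l + m)
    (embFF (Fin.castAddEmb m) (Fin.castAddEmb m).injective G *
     embFF (Fin.natAddEmb l) (Fin.natAddEmb l).injective H * shufKer l (l + m)) := rfl
  rw [e1, e2, shuf_symm_left, shuf_symm_right]
  unfold shuf
  rw [cast_symmize]
  congr 1
  unfold castFF
  simp only [map_mul, embFF_embFF]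
  have hA : embFF (Fin.castAddEmb m) (Fin.castAddEmb m).injective (shufKer k (k + l)) =
      KK (Finset.univ.filter (fun p : Fin (k + l + m) × Fin (k + l + m) =>
        (p.1 : ℕ) < k ∧ k ≤ (p.2 : ℕ) ∧ (p.2 : ℕ) < k + l)) := by
    rw [shufKer_eq]
    apply embFF_KK
    · intro a b
      simp
    · intro c d h
      simp only [Finset.mem_filter, Finset.mem_univ, true_and] at h
      exact ⟨⟨⟨c, by omega⟩, rfl⟩, ⟨⟨d, by omega⟩, rfl⟩⟩
  have hB : embFF (finCongr (Nat.add_assoc k l m).symm) (finCongr _).injective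
        (shufKer k (k + (l + m))) =
      KK (Finset.univ.filter (fun p : Fin (k + l + m) × Fin (k + l + m) =>
        (p.1 : ℕ) < k ∧ k ≤ (p.2 : ℕ))) := by
    rw [shufKer_eq]
    apply embFF_KK
    · intro a b
      simp
    · intro c d h
      exact ⟨(finCongr _).surjective c, (finCongr _).surjective d⟩
  have hC : embFF (finCongr (Nat.add_assoc k l m).symm ∘ Fin.natAddEmb k)
        ((finCongr _).injective.comp (Fin.natAddEmb k).injective)
        (shufKer l (l + m)) =
      KK (Finset.univ.filter (fun p : Fin (k + l + m) × Fin (k + l + m) =>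
        k ≤ (p.1 : ℕ) ∧ (p.1 : ℕ) < k + l ∧ k + l ≤ (p.2 : ℕ))) := by
    rw [shufKer_eq]
    apply embFF_KK
    · intro a b
      simp
    · intro c d h
      simp only [Finset.mem_filter, Finset.mem_univ, true_and] at h
      exact ⟨⟨⟨c - k, by omega⟩, by ext; simp; omega⟩, ⟨⟨d - k, by omega⟩, by ext; simp; omega⟩⟩
  rw [hA, hB, hC, shufKer_eq (k + l)]
  have hK := (KK_mul
      (Finset.univ.filter (fun p : Fin (k + l + m) × Fin (k + l + m) =>
        (p.1 : ℕ) < k ∧ k ≤ (p.2 : ℕ) ∧ (p.2 : ℕ) < k + l))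
      (Finset.univ.filter (fun p : Fin (k + l + m) × Fin (k + l + m) =>
        (p.1 : ℕ) < k + l ∧ k + l ≤ (p.2 : ℕ)))
      (Finset.univ.filter (fun p : Fin (k + l + m) × Fin (k + l + m) =>
        ((p.1 : ℕ) < k ∧ k ≤ (p.2 : ℕ)) ∨
          (k ≤ (p.1 : ℕ) ∧ (p.1 : ℕ) < k + l ∧ k + l ≤ (p.2 : ℕ))))
      (by intro p; simp only [Finset.mem_filter, Finset.mem_univ, true_and]; omega)
      (by intro p; simp only [Finset.mem_filter, Finset.mem_univ, true_and]; omega)).trans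
    (KK_mul
      (Finset.univ.filter (fun p : Fin (k + l + m) × Fin (k + l + m) =>
        k ≤ (p.1 : ℕ) ∧ (p.1 : ℕ) < k + l ∧ k + l ≤ (p.2 : ℕ)))
      (Finset.univ.filter (fun p : Fin (k + l + m) × Fin (k + l + m) =>
        (p.1 : ℕ) < k ∧ k ≤ (p.2 : ℕ)))
      _
      (by intro p; simp only [Finset.mem_filter, Finset.mem_univ, true_and]; omega)
      (by intro p; simp only [Finset.mem_filter, Finset.mem_univ, true_and]; omega)).symm
  have hF : embFF (Fin.castAddEmb m ∘ Fin.castAddEmb l)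
      ((Fin.castAddEmb m).injective.comp (Fin.castAddEmb l).injective) F =
      embFF (finCongr (Nat.add_assoc k l m).symm ∘ Fin.castAddEmb (l + m))
        ((finCongr _).injective.comp (Fin.castAddEmb (l + m)).injective) F := by
    apply embFF_congr
    funext a; ext; simp
  have hG : embFF (Fin.castAddEmb m ∘ Fin.natAddEmb k)
      ((Fin.castAddEmb m).injective.comp (Fin.natAddEmb k).injective) G =
      embFF ((finCongr (Nat.add_assoc k l m).symm ∘ Fin.natAddEmb k) ∘ Fin.castAddEmb m)
        (((finCongr _).injective.comp (Fin.natAddEmb k).injective).comp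
          (Fin.castAddEmb m).injective) G := by
    apply embFF_congr
    funext a; ext; simp
  have hH : embFF (Fin.natAddEmb (k + l)) (Fin.natAddEmb (k + l)).injective H =
      embFF ((finCongr (Nat.add_assoc k l m).symm ∘ Fin.natAddEmb k) ∘ Fin.natAddEmb l)
        (((finCongr _).injective.comp (Fin.natAddEmb k).injective).comp
          (Fin.natAddEmb l).injective) H := by
    apply embFF_congr
    funext a; ext; simp; omega
  simp only [Function.comp_assoc] at hF hG hH ⊢
  rw [hF, hG, hH]
  linear_combination (embFF (finCongr (Nat.add_assoc k l m).symm ∘ Fin.castAddEmb (l + m))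
        ((finCongr _).injective.comp (Fin.castAddEmb (l + m)).injective) F *
      embFF (finCongr (Nat.add_assoc k l m).symm ∘ Fin.natAddEmb k ∘ Fin.castAddEmb m)
        ((finCongr _).injective.comp ((Fin.natAddEmb k).injective.comp
          (Fin.castAddEmb m).injective)) G *
      embFF (finCongr (Nat.add_assoc k l m).symm ∘ Fin.natAddEmb k ∘ Fin.natAddEmb l)
        ((finCongr _).injective.comp ((Fin.natAddEmb k).injective.comp
          (Fin.natAddEmb l).injective)) H) * hK

theorem monProd_eq (n : ℕ) (lam : Fin n → ℤ) :
    monProd n lam =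
        symmize n ((∏ i : Fin n, xv i ^ (lam i)) *
          KK (Finset.univ.filter (fun p : Fin n × Fin n => p.1 < p.2))) := by
  induction n with
  | zero =>
    unfold monProd symmize KK
    simp
  | succ m ih =>
    rw [monProd, ih, shuf_symm_right, shuf, cast_symmize]
    congr 1
    unfold castFF
    simp only [map_mul, embFF_embFF, map_prod, map_zpow₀, embFF_xv]
    have hB : embFF (finCongr (Nat.add_comm 1 m)) (finCongr _).injective (shufKer 1 (1 + m)) =
        KK (Finset.univ.filter (fun p : Fin (m + 1) × Fin (m + 1) =>
          (p.1 : ℕ) < 1 ∧ 1 ≤ (p.2 : ℕ))) := by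
      rw [shufKer_eq]
      apply embFF_KK
      · intro a b
        simp
      · intro c d h
        exact ⟨(finCongr _).surjective c, (finCongr _).surjective d⟩
    have hC : embFF (finCongr (Nat.add_comm 1 m) ∘ Fin.natAddEmb 1)
          ((finCongr _).injective.comp (Fin.natAddEmb 1).injective)
          (KK (Finset.univ.filter (fun p : Fin m × Fin m => p.1 < p.2))) =
        KK (Finset.univ.filter (fun p : Fin (m + 1) × Fin (m + 1) =>
          1 ≤ (p.1 : ℕ) ∧ p.1 < p.2)) := by
      apply embFF_KK
      · intro a b
        simp only [Finset.mem_filter, Finset.mem_univ, true_and, Fin.lt_def]; simp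
      · intro c d h
        simp only [Finset.mem_filter, Finset.mem_univ, true_and, Fin.lt_def] at h
        exact ⟨⟨⟨c - 1, by omega⟩, by ext; simp; omega⟩, ⟨⟨d - 1, by omega⟩, by ext; simp; omega⟩⟩
    have hK := KK_mul
      (Finset.univ.filter (fun p : Fin (m + 1) × Fin (m + 1) => 1 ≤ (p.1 : ℕ) ∧ p.1 < p.2))
      (Finset.univ.filter (fun p : Fin (m + 1) × Fin (m + 1) => (p.1 : ℕ) < 1 ∧ 1 ≤ (p.2 : ℕ)))
      (Finset.univ.filter (fun p : Fin (m + 1) × Fin (m + 1) => p.1 < p.2))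
      (by intro p; simp only [Finset.mem_filter, Finset.mem_univ, true_and, Fin.lt_def]; omega)
      (by intro p; simp only [Finset.mem_filter, Finset.mem_univ, true_and, Fin.lt_def]; omega)
    rw [hB, hC, ← hK]
    rw [Fin.prod_univ_succ]
    have h0 : finCongr (Nat.add_comm 1 m) (Fin.castAddEmb m (0 : Fin 1)) = (0 : Fin (m + 1)) := by
      ext; simp
    have hs : ∀ i : Fin m, finCongr (Nat.add_comm 1 m) (Fin.natAddEmb 1 i) = i.succ := by
      intro i; ext; simp [Nat.add_comm]
    simp only [Function.comp_apply, h0, hs]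
    ring

/-- the shuffle product on symmetric rational functions (containing the
symmetric Laurent polynomials) is associative, and for any partition
`λ_1 ≥ λ_2 ≥ … ≥ λ_n` the iterated product `x^{λ_1} ⋆ ⋯ ⋆ x^{λ_n}` equals the
Hall–Littlewood Laurent polynomial
`P_λ = Sym_{S_n}(x_1^{λ_1} ⋯ x_n^{λ_n} ∏_{i<j} (x_i - v x_j)/(x_i - x_j))`. -/
theorem stmt17 :
    (∀ (k l m : ℕ) (F : FF k) (G : FF l) (H : FF m),
      SymmRF F → SymmRF G → SymmRF H →
        shuf (k + l) m (shuf k l F G) H =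
          castFF (Nat.add_assoc k l m).symm (shuf k (l + m) F (shuf l m G H))) ∧
    (∀ (n : ℕ) (lam : Fin n → ℤ), Antitone lam →
      monProd n lam =
        symmize n ((∏ i : Fin n, xv i ^ (lam i)) *
          ∏ p ∈ Finset.univ.filter (fun p : Fin n × Fin n => p.1 < p.2),
            (xv p.1 - vF * xv p.2) / (xv p.1 - xv p.2))) := by
  exact ⟨fun k l m F G H _ _ _ => shuf_assoc k l m F G H, fun n lam _ => monProd_eq n lam⟩
end

section
/- Let t >= 2 and let v in C be a primitive 2t-th root of unity. In the shuffle algebra Λ-bar over C (doubly skew-symmetric rational functions with kernels (x + v^{-1} y)/(x - y)), the following identity holds for 1 <= r < t: the t-fold shuffle product (x/(x-y)) ⋆ ... ⋆ (x/(x-y)) (r factors) ⋆ (1/(x-y)) ⋆ ... ⋆ (1/(x-y)) (t-r factors) equals c(v) · χ_r · Δ / ∏_{i,j}(x_i - y_j), where χ_r is the r-th elementary symmetric polynomial in x_1,...,x_t, Δ = ∏_{i<j}(x_i - x_j) ∏_{i<j}(y_i - y_j), and c(v) is a nonzero constant. -/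
open MvPolynomial Equiv

/-- The field of rational functions in `x_1,…,x_t, y_1,…,y_t` over ℂ. -/
noncomputable abbrev FW (t : ℕ) : Type := FractionRing (MvPolynomial (Fin t ⊕ Fin t) ℂ)

noncomputable def emb {t : ℕ} (P : MvPolynomial (Fin t ⊕ Fin t) ℂ) : FW t :=
  algebraMap (MvPolynomial (Fin t ⊕ Fin t) ℂ) (FW t) P

noncomputable def xw {t : ℕ} (i : Fin t) : FW t := emb (X (Sum.inl i))
noncomputable def yw {t : ℕ} (j : Fin t) : FW t := emb (X (Sum.inr j))

namespace St

lemma prod_pairs {M : Type*} [CommMonoid M] (n : ℕ) (f : Fin n → Fin n → M) :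
    ∏ p ∈ pairs n, f p.1 p.2 = ∏ a, ∏ b, if a < b then f a b else 1 := by
  rw [pairs, Finset.prod_filter, ← Finset.univ_product_univ, Finset.prod_product]

lemma prod_pairs_succ {M : Type*} [CommMonoid M] (n : ℕ) (f : Fin (n+1) → Fin (n+1) → M) :
    ∏ p ∈ pairs (n+1), f p.1 p.2 =
      (∏ b : Fin n, f 0 b.succ) * ∏ p ∈ pairs n, f p.1.succ p.2.succ := by
  rw [prod_pairs, prod_pairs n (fun a b => f a.succ b.succ), Fin.prod_univ_succ]
  simp [Fin.prod_univ_succ]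

lemma prod_all {M : Type*} [CommMonoid M] (n : ℕ) (g : Fin n → Fin n → M) :
    ∏ a, ∏ b, g a b = (∏ a, g a a) * ∏ p ∈ pairs n, (g p.1 p.2 * g p.2 p.1) := by
  rw [Finset.prod_mul_distrib, prod_pairs, prod_pairs n (fun a b => g b a)]
  rw [Finset.prod_comm (f := fun a b => if a < b then g b a else 1)]
  rw [← Finset.prod_mul_distrib, ← Finset.prod_mul_distrib]
  refine Finset.prod_congr rfl fun a _ => ?_
  have : g a a = ∏ b, if b = a then g a b else 1 := by simp
  rw [this, ← Finset.prod_mul_distrib, ← Finset.prod_mul_distrib]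
  refine Finset.prod_congr rfl fun b _ => ?_
  rcases lt_trichotomy a b with h | h | h
  · simp [h, h.ne', h.not_gt]
  · simp [h]
  · simp [h, h.ne, h.not_gt]

variable {K : Type*} [Field K]

lemma vand_pairs (n : ℕ) (x : Fin n → K) :
    (Matrix.vandermonde x).det = ∏ p ∈ pairs n, (x p.2 - x p.1) := by
  rw [Matrix.det_vandermonde, prod_pairs n (fun a b => x b - x a)]
  refine Finset.prod_congr rfl fun a _ => ?_
  rw [← Finset.prod_filter]
  refine Finset.prod_congr ?_ fun _ _ => rfl
  ext b; simp

lemma pairs_neg (n : ℕ) (x : Fin n → K) :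
    ∏ p ∈ pairs n, (x p.1 - x p.2) = (-1) ^ (pairs n).card * ∏ p ∈ pairs n, (x p.2 - x p.1) := by
  rw [← Finset.prod_const, ← Finset.prod_mul_distrib]
  exact Finset.prod_congr rfl fun _ _ => by ring

lemma vand_sign (n : ℕ) (x : Fin n → K) (σ : Perm (Fin n)) :
    ∏ p ∈ pairs n, (x (σ p.1) - x (σ p.2)) =
      ((Perm.sign σ : ℤ) : K) * ∏ p ∈ pairs n, (x p.1 - x p.2) := by
  rw [pairs_neg, pairs_neg n (fun a => x (σ a)), ← vand_pairs, ← vand_pairs n (fun a => x (σ a))]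
  have := Matrix.det_permute σ (Matrix.vandermonde x)
  have h2 : (Matrix.vandermonde x).submatrix σ id = Matrix.vandermonde (fun a => x (σ a)) := by
    ext i j; simp [Matrix.vandermonde_apply]
  rw [h2] at this
  rw [this]; ring

lemma vand_ne (n : ℕ) (x : Fin n → K) (hx : Function.Injective x) :
    ∏ p ∈ pairs n, (x p.1 - x p.2) ≠ 0 := by
  refine Finset.prod_ne_zero_iff.2 fun p hp => ?_
  simp only [pairs, Finset.mem_filter] at hp
  exact sub_ne_zero.2 fun h => hp.2.ne (hx h)

/-! Part A -/

open Polynomial in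
noncomputable def pol (n : ℕ) (q : K) (x : Fin n → K) (c : Fin n) : K[X] :=
  ∏ b, if b < c then Polynomial.C (x b) + Polynomial.C q * Polynomial.X
    else if c < b then Polynomial.X + Polynomial.C (q * x b) else 1

lemma pol_deg (n : ℕ) (q : K) (x : Fin n → K) (c : Fin n) : (pol n q x c).natDegree < n := by
  have h0 : 0 < n := c.pos
  have : pol n q x c = ∏ b ∈ Finset.univ.erase c,
    (if b < c then Polynomial.C (x b) + Polynomial.C q * Polynomial.X
    else if c < b then Polynomial.X + Polynomial.C (q * x b) else 1) := by
    rw [pol, ← Finset.mul_prod_erase _ _ (Finset.mem_univ c)]; simp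
  rw [this]
  have h1 := Polynomial.natDegree_prod_le (Finset.univ.erase c)
    (fun b => (if b < c then Polynomial.C (x b) + Polynomial.C q * Polynomial.X
    else if c < b then Polynomial.X + Polynomial.C (q * x b) else 1))
  have h2 : ∑ b ∈ Finset.univ.erase c, ((if b < c then Polynomial.C (x b) + Polynomial.C q * Polynomial.X
    else if c < b then Polynomial.X + Polynomial.C (q * x b) else 1)).natDegree ≤ 
      ∑ b ∈ Finset.univ.erase c, 1 := by
    refine Finset.sum_le_sum fun b _ => ?_
    split_ifs
    · compute_degree
    · compute_degree
    · simp
  simp only [Finset.sum_const, Finset.card_erase_of_mem (Finset.mem_univ c), Finset.card_univ, Fintype.card_fin, smul_eq_mul, mul_one] at h2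
  have := h1.trans h2
  omega

lemma pol_eval (n : ℕ) (q : K) (x : Fin n → K) (c : Fin n) (Y : K) :
    (pol n q x c).eval Y = ∏ b, if b < c then x b + q * Y else if c < b then Y + q * x b else 1 := by
  rw [pol, Polynomial.eval_prod]
  refine Finset.prod_congr rfl fun b _ => ?_
  split_ifs <;> simp

lemma pol_prod (n : ℕ) (q : K) (x y : Fin n → K) :
    ∏ c, (pol n q x c).eval (y c) =
      ∏ p ∈ pairs n, ((x p.1 + q * y p.2) * (y p.1 + q * x p.2)) := by
  have := prod_all n (fun c b => if b < c then x b + q * y c else if c < b then y c + q * x b else 1)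
  simp only [pol_eval]
  rw [this]
  simp only [lt_irrefl, if_false, Finset.prod_const_one, one_mul]
  refine Finset.prod_congr rfl fun p hp => ?_
  simp only [pairs, Finset.mem_filter] at hp
  simp [hp.2, hp.2.not_gt]; ring

/-- coefficient matrix -/
noncomputable def cm (n : ℕ) (q : K) (x : Fin n → K) : Matrix (Fin n) (Fin n) K :=
  Matrix.of fun i c => (pol n q x c).coeff i

lemma cm_mul (n : ℕ) (q : K) (x y : Fin n → K) :
    Matrix.of (fun j c => (pol n q x c).eval (y j)) = Matrix.vandermonde y * cm n q x := by
  ext j c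
  rw [Matrix.mul_apply]
  simp only [Matrix.of_apply, cm, Matrix.vandermonde_apply]
  rw [Polynomial.eval_eq_sum_range' (pol_deg n q x c), Finset.sum_range]
  exact Finset.sum_congr rfl fun _ _ => by ring

lemma cm_det (n : ℕ) (q : K) (hq : q ≠ 0) (x : Fin n → K) (hx : Function.Injective x) :
    (cm n q x).det = (-1) ^ (pairs n).card * ∏ p ∈ pairs n, (x p.1 - q^2 * x p.2) := by
  have h := congrArg Matrix.det (cm_mul n q x (fun j => - q * x j))
  rw [Matrix.det_mul, vand_pairs, Matrix.det_of_upperTriangular] at h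
  · simp only [Matrix.of_apply] at h
    rw [pol_prod n q x (fun j => - q * x j), Finset.prod_mul_distrib] at h
    have e1 : ∏ p ∈ pairs n, (-q * x p.1 + q * x p.2) = q ^ (pairs n).card * ∏ p ∈ pairs n, (x p.2 - x p.1) := by
      rw [← Finset.prod_const, ← Finset.prod_mul_distrib]
      exact Finset.prod_congr rfl fun _ _ => by ring
    have e2 : ∏ p ∈ pairs n, (-q * x p.2 - -q * x p.1) = (-1) ^ (pairs n).card * (q ^ (pairs n).card * ∏ p ∈ pairs n, (x p.2 - x p.1)) := by
      rw [← Finset.prod_const, ← Finset.prod_const, ← Finset.prod_mul_distrib, ← Finset.prod_mul_distrib]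
      exact Finset.prod_congr rfl fun _ _ => by ring
    have e3 : ∏ p ∈ pairs n, (x p.1 + q * (-q * x p.2)) = ∏ p ∈ pairs n, (x p.1 - q^2 * x p.2) :=
      Finset.prod_congr rfl fun _ _ => by ring
    rw [e1, e2, e3] at h
    have hne : q ^ (pairs n).card * ∏ p ∈ pairs n, (x p.2 - x p.1) ≠ 0 := by
      refine mul_ne_zero (pow_ne_zero _ hq) ?_
      have := vand_ne n x hx
      rw [pairs_neg] at this
      exact right_ne_zero_of_mul this
    have hs : ((-1 : K) ^ (pairs n).card) * (-1) ^ (pairs n).card = 1 := by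
      rw [← mul_pow]; simp
    apply mul_right_cancel₀ hne
    linear_combination (-(-1 : K) ^ (pairs n).card) * h - ((q ^ (pairs n).card * ∏ p ∈ pairs n, (x p.2 - x p.1)) * (cm n q x).det) * hs
  · intro i j hij
    simp only [Matrix.of_apply, pol_eval]
    apply Finset.prod_eq_zero (Finset.mem_univ i)
    have : j < i := by simpa using hij
    simp [this, this.not_gt]

lemma partA (n : ℕ) (q : K) (hq : q ≠ 0) (x y : Fin n → K) (hx : Function.Injective x) :
    ∑ τ : Perm (Fin n), ((Perm.sign τ : ℤ) : K) *
      ∏ p ∈ pairs n, ((x p.1 + q * y (τ p.2)) * (y (τ p.1) + q * x p.2)) =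
    (∏ p ∈ pairs n, (y p.1 - y p.2)) * ∏ p ∈ pairs n, (x p.1 - q^2 * x p.2) := by
  have h := congrArg Matrix.det (cm_mul n q x y)
  rw [Matrix.det_mul, cm_det n q hq x hx, vand_pairs, Matrix.det_apply'] at h
  simp only [Matrix.of_apply] at h
  rw [pairs_neg n y]
  have e : ∀ τ : Perm (Fin n), _ := fun τ => pol_prod n q x (fun a => y (τ a))
  simp only [← e]
  rw [h]; ring

/-! Part B -/

noncomputable def EE {ι : Type*} (S : Finset ι) (x : ι → K) : Polynomial K :=
  ∏ j ∈ S, (1 + Polynomial.C (x j) * Polynomial.X)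

noncomputable def phi (s a b : K) : K := (a - s * b) / (a - b)

lemma EE_deg {ι : Type*} (S : Finset ι) (x : ι → K) : (EE S x).natDegree ≤ S.card := by
  refine (Polynomial.natDegree_prod_le _ _).trans ?_
  rw [Finset.card_eq_sum_ones]
  refine Finset.sum_le_sum fun j _ => ?_
  compute_degree

lemma EE_eval {ι : Type*} (S : Finset ι) (x : ι → K) (z : K) :
    (EE S x).eval z = ∏ j ∈ S, (1 + x j * z) := by
  simp [EE, Polynomial.eval_prod]

lemma EE_coeff {ι : Type*} (S : Finset ι) (x : ι → K) (r : ℕ) :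
    (EE S x).coeff r = ∑ T ∈ S.powersetCard r, ∏ j ∈ T, x j := by
  classical
  rw [EE, Finset.prod_one_add, Polynomial.finsetSum_coeff]
  simp only [Finset.prod_mul_distrib, Finset.prod_const, ← map_prod, Polynomial.coeff_C_mul_X_pow]
  rw [← Finset.sum_filter]
  refine Finset.sum_congr ?_ fun _ _ => rfl
  ext T
  simp [Finset.mem_powersetCard, eq_comm]

lemma lagr (n : ℕ) (s : K) (x : Fin n → K) (hx : Function.Injective x) (h0 : ∀ i, x i ≠ 0) :
    Polynomial.C (1 - s) * ∑ i, (Polynomial.C (x i * ∏ j ∈ Finset.univ.erase i, phi s (x i) (x j)) *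
      EE (Finset.univ.erase i) x) * Polynomial.X =
    EE Finset.univ x - (EE Finset.univ x).comp (Polynomial.C s * Polynomial.X) := by
  have hE : (EE Finset.univ x).natDegree ≤ n := by simpa using EE_deg Finset.univ x
  refine Polynomial.eq_of_natDegree_lt_card_of_eval_eq (ι := Option (Fin n)) _ _
    (f := fun o => o.elim 0 (fun k => - (x k)⁻¹)) ?_ ?_ ?_
  · rintro (_ | a) (_ | b) h
    · rfl
    · simp [h0] at h
    · simp [h0] at h
    · simp at h; rw [hx h]
  · rintro (_ | k)
    · simp [EE_eval, Polynomial.eval_finsetSum]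
    · simp only [Option.elim, Polynomial.eval_mul, Polynomial.eval_sub, Polynomial.eval_finsetSum, Polynomial.eval_comp, Polynomial.eval_C, Polynomial.eval_X, EE_eval]
      rw [Finset.sum_eq_single k]
      · have a1 : ∏ j, (1 + x j * (-(x k)⁻¹)) = 0 :=
          Finset.prod_eq_zero (Finset.mem_univ k) (by have := h0 k; field_simp; ring)
        rw [a1, ← Finset.mul_prod_erase _ _ (Finset.mem_univ k)]
        have a2 : (∏ j ∈ Finset.univ.erase k, phi s (x k) (x j)) * ∏ j ∈ Finset.univ.erase k, (1 + x j * (-(x k)⁻¹)) = ∏ j ∈ Finset.univ.erase k, (1 + x j * (s * -(x k)⁻¹)) := by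
          rw [← Finset.prod_mul_distrib]
          refine Finset.prod_congr rfl fun j hj => ?_
          have hj : x k - x j ≠ 0 := sub_ne_zero.2 fun h => (Finset.ne_of_mem_erase hj) (hx h).symm
          have := h0 k
          rw [phi]; field_simp; ring
        rw [← a2]
        have := h0 k
        field_simp
        ring
      · intro i _ hik
        have : ∏ j ∈ Finset.univ.erase i, (1 + x j * (-(x k)⁻¹)) = 0 :=
          Finset.prod_eq_zero (Finset.mem_erase.2 ⟨hik.symm, Finset.mem_univ k⟩) (by have := h0 k; field_simp; ring)
        rw [this]; ring
      · simp
  · simp only [Fintype.card_option, Fintype.card_fin]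
    refine max_lt ?_ ?_
    · refine Nat.lt_succ_of_le ((Polynomial.natDegree_C_mul_le _ _).trans ?_)
      refine Polynomial.natDegree_sum_le_of_forall_le _ _ fun i _ => ?_
      have h1 := EE_deg (Finset.univ.erase i) x
      simp at h1
      have := i.pos
      refine Polynomial.natDegree_mul_le.trans ?_
      have := Polynomial.natDegree_C_mul_le (x i * ∏ j ∈ Finset.univ.erase i, phi s (x i) (x j)) (EE (Finset.univ.erase i) x)
      have := Polynomial.natDegree_X_le (R := K)
      omega
    · refine Nat.lt_succ_of_le ((Polynomial.natDegree_sub_le _ _).trans (max_le hE ?_))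
      refine Polynomial.natDegree_comp_le.trans ?_
      have : (Polynomial.C s * Polynomial.X).natDegree ≤ 1 := by compute_degree
      nlinarith

noncomputable def br (s : K) (k : ℕ) : K := ∑ i ∈ Finset.range k, s ^ i
noncomputable def fc (s : K) (k : ℕ) : K := ∏ i ∈ Finset.range k, br s (i + 1)

lemma lagr_coeff (n : ℕ) (s : K) (hs : s ≠ 1) (x : Fin n → K) (hx : Function.Injective x)
    (h0 : ∀ i, x i ≠ 0) (m : ℕ) :
    ∑ i, x i * (∏ j ∈ Finset.univ.erase i, phi s (x i) (x j)) * (EE (Finset.univ.erase i) x).coeff m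
      = br s (m+1) * (EE Finset.univ x).coeff (m+1) := by
  have h := congrArg (fun P => Polynomial.coeff P (m+1)) (lagr n s x hx h0)
  simp only [Polynomial.coeff_C_mul, Polynomial.finsetSum_coeff, Polynomial.coeff_mul_X, Polynomial.coeff_sub, Polynomial.comp_C_mul_X_coeff] at h
  have hb : br s (m+1) * (1 - s) = 1 - s^(m+1) := geom_sum_mul_neg s (m+1)
  apply mul_left_cancel₀ (sub_ne_zero.2 hs.symm)
  rw [h]
  linear_combination (-(EE Finset.univ x).coeff (m+1)) * hb

noncomputable def kk (s : K) (n r : ℕ) (x : Fin n → K) : K :=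
  ∑ σ : Perm (Fin n), (∏ a : Fin n, if (a : ℕ) < r then x (σ a) else 1) *
    ∏ p ∈ pairs n, phi s (x (σ p.1)) (x (σ p.2))

lemma prod_swap {M : Type*} [CommMonoid M] (n : ℕ) (p : Fin (n+1)) (f : Fin (n+1) → M) :
    ∏ b : Fin n, f (swap 0 p b.succ) = ∏ j ∈ Finset.univ.erase p, f j := by
  have e : Finset.univ.erase p = (Finset.univ : Finset (Fin n)).map
      ((Fin.succEmb n).trans (swap 0 p).toEmbedding) := by
    ext j
    simp only [Finset.mem_erase, Finset.mem_univ, and_true, Finset.mem_map, true_and]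
    constructor
    · intro h
      have : swap 0 p j ≠ 0 := by
        intro h'
        apply h
        rw [Equiv.swap_apply_eq_iff] at h'
        simpa using h'
      obtain ⟨b, hb⟩ := Fin.exists_succ_eq.2 this
      exact ⟨b, by simp [hb]⟩
    · rintro ⟨b, rfl⟩ h
      simp at h
      have : swap 0 p b.succ = swap 0 p 0 := by rw [h]; simp
      exact Fin.succ_ne_zero b ((swap 0 p).injective this)
  rw [e, Finset.prod_map]; rfl

lemma kk_succ (s : K) (n m : ℕ) (x : Fin (n+1) → K) :
    kk s (n+1) (m+1) x = ∑ p, x p * (∏ j ∈ Finset.univ.erase p, phi s (x p) (x j)) *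
      kk s n m (fun b => x (swap 0 p b.succ)) := by
  rw [kk, ← Equiv.sum_comp Perm.decomposeFin.symm, Fintype.sum_prod_type]
  refine Finset.sum_congr rfl fun p _ => ?_
  rw [kk, Finset.mul_sum]
  refine Finset.sum_congr rfl fun e _ => ?_
  rw [Fin.prod_univ_succ, prod_pairs_succ n (fun a b => phi s (x (Perm.decomposeFin.symm (p, e) a)) (x (Perm.decomposeFin.symm (p, e) b)))]
  simp only [Perm.decomposeFin_symm_apply_zero, Perm.decomposeFin_symm_apply_succ, Fin.val_succ, Fin.val_zero, add_lt_add_iff_right]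
  rw [Equiv.prod_comp e (fun b => phi s (x p) (x (swap 0 p b.succ))), prod_swap n p (fun j => phi s (x p) (x j))]
  simp only [Nat.zero_lt_succ, if_true]
  ring

lemma partB (s : K) (hs : s ≠ 1) (n : ℕ) : ∀ (x : Fin n → K) (_ : Function.Injective x)
    (_ : ∀ i, x i ≠ 0) (r : ℕ) (_ : r ≤ n),
    kk s n r x = fc s r * fc s (n - r) * (EE Finset.univ x).coeff r := by
  induction n with
  | zero =>
    intro x _ _ r hr
    obtain rfl : r = 0 := by omega
    simp [kk, fc, EE, pairs]
  | succ n ih =>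
    intro x hx h0 r hr
    have key : ∀ m ≤ n, kk s (n+1) (m+1) x =
        fc s (m+1) * fc s (n + 1 - (m+1)) * (EE Finset.univ x).coeff (m+1) := by
      intro m hm
      rw [kk_succ, fc, Finset.prod_range_succ, ← fc]
      have := lagr_coeff (n+1) s hs x hx h0 m
      rw [show fc s m * br s (m+1) * fc s (n+1-(m+1)) * (EE Finset.univ x).coeff (m+1) = fc s m * fc s (n-m) * (br s (m+1) * (EE Finset.univ x).coeff (m+1)) by rw [Nat.add_sub_add_right]; ring, ← this, Finset.mul_sum]
      refine Finset.sum_congr rfl fun p _ => ?_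
      rw [ih (fun b => x (swap 0 p b.succ)) (fun a b h => Fin.succ_injective _ ((swap 0 p).injective (hx h))) (fun _ => h0 _) m hm]
      have : EE Finset.univ (fun b : Fin n => x (swap 0 p b.succ)) = EE (Finset.univ.erase p) x := by
        rw [EE, EE, prod_swap n p (fun j => 1 + Polynomial.C (x j) * Polynomial.X)]
      rw [this]; ring
    rcases r with _ | m
    · have h1 := key n le_rfl
      have h2 : kk s (n+1) (n+1) x = (∏ j, x j) * kk s (n+1) 0 x := by
        rw [kk, kk, Finset.mul_sum]
        refine Finset.sum_congr rfl fun σ _ => ?_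
        simp only [Fin.is_lt, if_true, not_lt_zero, if_false, Finset.prod_const_one, one_mul]
        rw [Equiv.prod_comp σ x]
      have h3 : (EE Finset.univ x).coeff (n+1) = ∏ j, x j := by
        rw [EE_coeff]
        have := Finset.powersetCard_self (Finset.univ : Finset (Fin (n+1)))
        simp only [Finset.card_univ, Fintype.card_fin] at this
        rw [this]; simp
      have h4 : (EE Finset.univ x).coeff 0 = 1 := by
        rw [EE_coeff]; simp
      have h5 : ∏ j, x j ≠ 0 := Finset.prod_ne_zero_iff.2 fun j _ => h0 j
      rw [h2, h3] at h1
      apply mul_left_cancel₀ h5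
      rw [h1, h4]; simp [fc]; ring
    · exact key m (by omega)

lemma main_field (n r : ℕ) (hr : r ≤ n) (q : K) (hq : q ≠ 0) (hq2 : q ^ 2 ≠ 1) (x y : Fin n → K)
    (hx : Function.Injective x) (h0 : ∀ i, x i ≠ 0) :
    (∑ σ : Perm (Fin n), ∑ τ : Perm (Fin n),
          (((Perm.sign σ : ℤ) * (Perm.sign τ : ℤ) : ℤ) : K) *
          (∏ a : Fin n,
            (if (a : ℕ) < r then x (σ a) else 1) / (x (σ a) - y (τ a))) *
          ∏ p ∈ pairs n,
            ((x (σ p.1) + q * y (τ p.2)) / (x (σ p.1) - y (τ p.2))) *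
            ((y (τ p.1) + q * x (σ p.2)) / (y (τ p.1) - x (σ p.2)))) =
      ((-1) ^ (pairs n).card * fc (q^2) r * fc (q^2) (n - r)) * (EE Finset.univ x).coeff r *
        ((∏ p ∈ pairs n, (x p.1 - x p.2)) * ∏ p ∈ pairs n, (y p.1 - y p.2)) /
        ∏ i : Fin n, ∏ j : Fin n, (x i - y j) := by
  have hden : ∀ σ τ : Perm (Fin n), (∏ a : Fin n, (x (σ a) - y (τ a))) *
      ∏ p ∈ pairs n, ((x (σ p.1) - y (τ p.2)) * (y (τ p.1) - x (σ p.2))) =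
      (-1) ^ (pairs n).card * ∏ i : Fin n, ∏ j : Fin n, (x i - y j) := by
    intro σ τ
    have h1 : ∏ i : Fin n, ∏ j : Fin n, (x i - y j) = ∏ i : Fin n, ∏ j : Fin n, (x (σ i) - y (τ j)) := by
      rw [← Equiv.prod_comp σ]
      refine Finset.prod_congr rfl fun i _ => ?_
      rw [← Equiv.prod_comp τ]
    rw [h1, prod_all, mul_left_comm, ← Finset.prod_const, ← Finset.prod_mul_distrib]
    congr 1
    exact Finset.prod_congr rfl fun _ _ => by ring
  have hε : ((-1 : K) ^ (pairs n).card)⁻¹ = (-1) ^ (pairs n).card := by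
    rw [← inv_pow]; norm_num
  have hterm : ∀ σ τ : Perm (Fin n), (((Perm.sign σ : ℤ) * (Perm.sign τ : ℤ) : ℤ) : K) *
          (∏ a : Fin n,
            (if (a : ℕ) < r then x (σ a) else 1) / (x (σ a) - y (τ a))) *
          ∏ p ∈ pairs n,
            ((x (σ p.1) + q * y (τ p.2)) / (x (σ p.1) - y (τ p.2))) *
            ((y (τ p.1) + q * x (σ p.2)) / (y (τ p.1) - x (σ p.2))) =
      ((-1) ^ (pairs n).card / ∏ i : Fin n, ∏ j : Fin n, (x i - y j)) *
        (((Perm.sign σ : ℤ) : K) * (∏ a : Fin n, if (a : ℕ) < r then x (σ a) else 1)) *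
        (((Perm.sign τ : ℤ) : K) * ∏ p ∈ pairs n, ((x (σ p.1) + q * y (τ p.2)) * (y (τ p.1) + q * x (σ p.2)))) := by
    intro σ τ
    have e1 : ∀ p : Fin n × Fin n, ((x (σ p.1) + q * y (τ p.2)) / (x (σ p.1) - y (τ p.2))) *
            ((y (τ p.1) + q * x (σ p.2)) / (y (τ p.1) - x (σ p.2))) =
        ((x (σ p.1) + q * y (τ p.2)) * (y (τ p.1) + q * x (σ p.2))) / 
        ((x (σ p.1) - y (τ p.2)) * (y (τ p.1) - x (σ p.2))) := fun p => div_mul_div_comm _ _ _ _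
    simp only [e1]
    rw [Finset.prod_div_distrib, Finset.prod_div_distrib, mul_assoc, div_mul_div_comm, hden]
    push_cast
    rw [div_eq_mul_inv _ ((-1) ^ (pairs n).card * _), mul_inv, hε]
    ring
  simp only [hterm]
  simp only [← Finset.mul_sum]
  have hA : ∀ σ : Perm (Fin n), _ := fun σ => partA n q hq (fun a => x (σ a)) y (hx.comp σ.injective)
  simp only [hA]
  have hB := partB (q^2) hq2 n x hx h0 r hr
  have hV := vand_ne n x hx
  have hC : ∀ σ : Perm (Fin n), ((Perm.sign σ : ℤ) : K) * ∏ p ∈ pairs n, (x (σ p.1) - q^2 * x (σ p.2)) =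
     (∏ p ∈ pairs n, (x p.1 - x p.2)) * ∏ p ∈ pairs n, phi (q^2) (x (σ p.1)) (x (σ p.2)) := by
    intro σ
    have h1 := vand_sign n x σ
    have h2 : ((Perm.sign σ : ℤ) : K) * ((Perm.sign σ : ℤ) : K) = 1 := by
      rw [← Int.cast_mul, ← Units.val_mul, Int.units_mul_self]; simp
    have h3 : ∏ p ∈ pairs n, (x (σ p.1) - q^2 * x (σ p.2)) =
       (∏ p ∈ pairs n, (x (σ p.1) - x (σ p.2))) * ∏ p ∈ pairs n, phi (q^2) (x (σ p.1)) (x (σ p.2)) := by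
      rw [← Finset.prod_mul_distrib]
      refine Finset.prod_congr rfl fun p hp => ?_
      simp only [pairs, Finset.mem_filter] at hp
      have : x (σ p.1) - x (σ p.2) ≠ 0 :=
        sub_ne_zero.2 fun h => hp.2.ne (σ.injective (hx h))
      rw [phi]; field_simp
    rw [h3, h1]
    linear_combination ((∏ p ∈ pairs n, (x p.1 - x p.2)) * ∏ p ∈ pairs n, phi (q^2) (x (σ p.1)) (x (σ p.2))) * h2
  have hD : ∀ σ : Perm (Fin n), 
      ((-1) ^ (pairs n).card / ∏ i : Fin n, ∏ j : Fin n, (x i - y j)) *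
        (((Perm.sign σ : ℤ) : K) * (∏ a : Fin n, if (a : ℕ) < r then x (σ a) else 1)) *
        ((∏ p ∈ pairs n, (y p.1 - y p.2)) * ∏ p ∈ pairs n, (x (σ p.1) - q^2 * x (σ p.2))) =
      ((-1) ^ (pairs n).card / ∏ i : Fin n, ∏ j : Fin n, (x i - y j)) * (∏ p ∈ pairs n, (y p.1 - y p.2)) *
        (∏ p ∈ pairs n, (x p.1 - x p.2)) * ((∏ a : Fin n, if (a : ℕ) < r then x (σ a) else 1) *
          ∏ p ∈ pairs n, phi (q^2) (x (σ p.1)) (x (σ p.2))) := by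
    intro σ
    linear_combination (((-1) ^ (pairs n).card / ∏ i : Fin n, ∏ j : Fin n, (x i - y j)) * (∏ p ∈ pairs n, (y p.1 - y p.2)) *
      (∏ a : Fin n, if (a : ℕ) < r then x (σ a) else 1)) * hC σ
  simp only [hD]
  rw [← Finset.mul_sum, ← kk, hB]
  ring

lemma fc_ne (s : ℂ) (t k : ℕ) (hs : IsPrimitiveRoot s t) (hk : k < t) : fc s k ≠ 0 := by
  rw [fc]
  refine Finset.prod_ne_zero_iff.2 fun i hi h => ?_
  rw [Finset.mem_range] at hi
  have h1 := geom_sum_mul s (i+1)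
  rw [← br, h, zero_mul] at h1
  exact hs.pow_ne_one_of_pos_of_lt (Nat.succ_ne_zero i) (by omega) (sub_eq_zero.1 h1.symm)

lemma fc_map {L : Type*} [Field L] (f : K →+* L) (s : K) (k : ℕ) : f (fc s k) = fc (f s) k := by
  simp [fc, br]

end St

/-- let `v` be a primitive `2t`-th root of unity, `t ≥ 2`, `1 ≤ r < t`.
The `t`-fold shuffle product of `r` copies of `x/(x-y)` followed by `t-r` copies of
`1/(x-y)` (written out, by associativity, as the doubly skew-symmetrization of the
product of the factors and all cross kernels `(x + v⁻¹y)/(x-y)`, `(y + v⁻¹x)/(y-x)`)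
equals `c(v)·χ_r·Δ / ∏_{i,j}(x_i - y_j)` for some nonzero constant `c(v)`, where `χ_r`
is the `r`-th elementary symmetric polynomial in `x_1,…,x_t` and
`Δ = ∏_{i<j}(x_i-x_j) ∏_{i<j}(y_i-y_j)`. -/
theorem stmt19 (t : ℕ) (ht : 2 ≤ t) (v : ℂ) (hv : IsPrimitiveRoot v (2 * t))
    (r : ℕ) (hr1 : 1 ≤ r) (hrt : r < t) :
    ∃ c : ℂ, c ≠ 0 ∧
      ((t.factorial * t.factorial : FW t))⁻¹ *
        (∑ σ : Perm (Fin t), ∑ τ : Perm (Fin t),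
          (((Perm.sign σ : ℤ) * (Perm.sign τ : ℤ) : ℤ) : FW t) *
          (∏ a : Fin t,
            (if (a : ℕ) < r then xw (σ a) else 1) / (xw (σ a) - yw (τ a))) *
          ∏ p ∈ pairs t,
            ((xw (σ p.1) + emb (C v⁻¹) * yw (τ p.2)) / (xw (σ p.1) - yw (τ p.2))) *
            ((yw (τ p.1) + emb (C v⁻¹) * xw (σ p.2)) / (yw (τ p.1) - xw (σ p.2)))) =
      emb (C c) * emb (rename Sum.inl (esymm (Fin t) ℂ r)) *
        ((∏ p ∈ pairs t, (xw p.1 - xw p.2)) * ∏ p ∈ pairs t, (yw p.1 - yw p.2)) /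
        ∏ i : Fin t, ∏ j : Fin t, (xw i - yw j) := by
  have hv0 : v ≠ 0 := hv.ne_zero (by omega)
  have hs : IsPrimitiveRoot (v⁻¹ ^ 2) t := hv.inv.pow (by omega) rfl
  have hinj : Function.Injective (algebraMap (MvPolynomial (Fin t ⊕ Fin t) ℂ) (FW t)) :=
    IsFractionRing.injective _ _
  let f : ℂ →+* FW t := (algebraMap (MvPolynomial (Fin t ⊕ Fin t) ℂ) (FW t)).comp C
  have hf : ∀ a, emb (C a) = f a := fun a => rfl
  have hx : Function.Injective (xw : Fin t → FW t) := fun a b h => by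
    have := X_injective (hinj h)
    simpa using this
  have h0 : ∀ i : Fin t, (xw i : FW t) ≠ 0 := fun i h => by
    have h' : algebraMap (MvPolynomial (Fin t ⊕ Fin t) ℂ) (FW t) (X (Sum.inl i)) = 0 := h
    rw [map_eq_zero_iff _ hinj] at h'
    exact X_ne_zero _ h'
  have hq : f v⁻¹ ≠ 0 := by simpa using hv0
  have hq2 : f v⁻¹ ^ 2 ≠ 1 := by
    rw [← map_pow, ← map_one f]
    intro h
    exact hs.ne_one (by omega) (f.injective h)
  have hE : (St.EE Finset.univ (xw : Fin t → FW t)).coeff r =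
      emb (rename Sum.inl (esymm (Fin t) ℂ r)) := by
    rw [St.EE_coeff, esymm, emb]
    simp [xw, emb]
  have hmain := St.main_field t r hrt.le (f v⁻¹) hq hq2 xw yw hx h0
  refine ⟨((t.factorial * t.factorial : ℂ))⁻¹ *
    ((-1) ^ (pairs t).card * St.fc (v⁻¹ ^ 2) r * St.fc (v⁻¹ ^ 2) (t - r)), ?_, ?_⟩
  · have hfac : (t.factorial : ℂ) ≠ 0 := by exact_mod_cast t.factorial_ne_zero
    refine mul_ne_zero (inv_ne_zero (mul_ne_zero hfac hfac)) (mul_ne_zero (mul_ne_zero ?_ ?_) ?_)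
    · exact pow_ne_zero _ (by norm_num)
    · exact St.fc_ne _ t r hs hrt
    · exact St.fc_ne _ t (t - r) hs (by omega)
  · rw [hf, hf, hmain, hE]
    simp only [map_mul, map_inv₀, map_pow, map_neg, map_one, map_natCast, St.fc_map]
    ring
end
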